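/- arXiv:math/0305393 — 7 statements merged into one kernel-verified Lean document; each statement's English description precedes it below -/
import Mathlib

section
/- Let q and n be positive integers. For every permutation σ of {1,…,n}, the q-length equals the q-inversion number: ℓ_q(σ) = inv_q(σ). -/
open Finset

/-- The Coxeter generator `s_j = (j, j+1)` of the symmetric group on `{1,…,m}`,
viewed as a permutation of `ℕ` (with 1-based positions). -/
def sgen (j : ℕ) : Equiv.Perm ℕ := Equiv.swap j (j + 1)

/-- The permutation determined by a word in the Coxeter generators,
letters read from left to right and composed as functions. -/
def wordPerm (L : List ℕ) : Equiv.Perm ℕ := (L.map sgen).prod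

/-- The canonical presentation of a permutation of `{1,…,m}` (given as a permutation of `ℕ`
supported on `{1,…,m}`): the unique factorization `w = w₁ w₂ ⋯ w_{m-1}` with
`w_j ∈ R_j = {1, s_j, s_j s_{j-1}, …, s_j ⋯ s_1}`, recorded as the list of indices of the
Coxeter generators appearing, read from left to right. -/
def canonWord : ℕ → Equiv.Perm ℕ → List ℕ
  | 0, _ => []
  | m + 1, π =>
      canonWord m
          (π * (wordPerm ((List.range' (π⁻¹ (m + 1)) (m + 1 - π⁻¹ (m + 1))).reverse))⁻¹)
        ++ (List.range' (π⁻¹ (m + 1)) (m + 1 - π⁻¹ (m + 1))).reverse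

def finIccEquiv (m : ℕ) : Fin m ≃ {i : ℕ // i ∈ Finset.Icc 1 m} where
  toFun a := ⟨a.1 + 1, by have := a.isLt; simp only [Finset.mem_Icc]; omega⟩
  invFun b := ⟨b.1 - 1, by have := b.2; simp only [Finset.mem_Icc] at this; omega⟩
  left_inv a := by ext; simp
  right_inv b := by
    have := b.2
    simp only [Finset.mem_Icc] at this
    ext
    simp only []
    omega

/-- A permutation of `{1,…,m}`, i.e. of `Fin m`, viewed as a permutation of `ℕ`
(moving only the points `1,…,m`, with `i ∈ Fin m` corresponding to the point `i+1`). -/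
def natPerm {m : ℕ} (π : Equiv.Perm (Fin m)) : Equiv.Perm ℕ :=
  π.extendDomain (finIccEquiv m)

/-- `Del_q` of a permutation of `{1,…,m}`: the set of positions `q+1 ≤ i ≤ m` that are
`(q-1)`-st almost left-to-right minima, i.e. `#{j < i : π(j) < π(i)} ≤ q - 1`. -/
def DelQ (q m : ℕ) (π : Equiv.Perm ℕ) : Finset ℕ :=
  (Finset.Icc (q + 1) m).filter fun i =>
    ((Finset.Ico 1 i).filter fun j => π j < π i).card ≤ q - 1

/-- The descent set of a permutation of `{1,…,m}`: positions `1 ≤ i ≤ m-1` with `π(i) > π(i+1)`. -/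
def DesSet (m : ℕ) (π : Equiv.Perm ℕ) : Finset ℕ :=
  (Finset.Icc 1 (m - 1)).filter fun i => π (i + 1) < π i

/-- `Des_q(π) = (Des(π) ∩ {q,…,m-1}) ∪ (Del_q(π) - 1)`. -/
def DesQ (q m : ℕ) (π : Equiv.Perm ℕ) : Finset ℕ :=
  DesSet m π ∩ Finset.Icc q (m - 1) ∪ (DelQ q m π).image (fun i => i - 1)

/-- The `q`-inversion number of a permutation of `{1,…,m}`:
`inv_q(π) = Σ_{i=q+1}^m min(i-q, #{j < i : π(j) > π(i)})`. -/
def invQ (q m : ℕ) (π : Equiv.Perm ℕ) : ℕ :=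
  ∑ i ∈ Finset.Icc (q + 1) m,
    min (i - q) ((Finset.Ico 1 i).filter fun j => π i < π j).card

/-- The `q`-reverse major index `rmaj_{q,m}(π) = Σ_{i ∈ Des_q(π)} (m - i)`. -/
def rmajQ (q m : ℕ) (π : Equiv.Perm ℕ) : ℕ :=
  ∑ i ∈ DesQ q m π, (m - i)

/-- The `q`-length of a permutation of `{1,…,m}`: the number of letters in the canonical
presentation, where the generators `s_1, …, s_{q-1}` are not counted. -/
def ellQ (q m : ℕ) (π : Equiv.Perm ℕ) : ℕ :=
  ((canonWord m π).filter fun j => q ≤ j).length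

/-- `del_q` of a permutation of `{1,…,m}`: the number of occurrences of the generator `s_q`
in the canonical presentation. -/
def delq (q m : ℕ) (π : Equiv.Perm ℕ) : ℕ := (canonWord m π).count q

/-- The covering map `f_q : S_m → S_{m-q+1}`, defined on the canonical presentation by
`s_j ↦ 1` if `j ≤ q-1` and `s_j ↦ s_{j-q+1}` if `j ≥ q`. -/
def fq (q m : ℕ) (π : Equiv.Perm ℕ) : Equiv.Perm ℕ :=
  wordPerm (((canonWord m π).filter fun j => q ≤ j).map fun j => j - q + 1)

/-- A permutation of `{1,…,m}` avoids the pattern set `Pat(q)` iff there is no sequence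
`1 ≤ i₁ < i₂ < ⋯ < i_{q+1} < m` with `π(i_{q+1}) > π(i_{q+1}+1)` and
`π(i_j) < π(i_{q+1}+1)` for all `1 ≤ j ≤ q`. -/
def AvoidsPat (q m : ℕ) (π : Equiv.Perm ℕ) : Prop :=
  ¬ ∃ f : Fin (q + 1) → ℕ, StrictMono f ∧ 1 ≤ f 0 ∧ f (Fin.last q) < m ∧
      π (f (Fin.last q) + 1) < π (f (Fin.last q)) ∧
      ∀ a : Fin (q + 1), a ≠ Fin.last q → π (f a) < π (f (Fin.last q) + 1)

/-- The Stirling number of the second kind `S(n,k)`: the number of partitions of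
`{1,…,n}` into `k` nonempty blocks. -/
noncomputable def stirling2 (n k : ℕ) : ℕ :=
  Nat.card {P : Finpartition (Finset.univ : Finset (Fin n)) // P.parts.card = k}

/-- The `q`-Bell number `b_q(n) = Σ_k q^k S(n,k)`. -/
noncomputable def qBell (q n : ℕ) : ℕ := ∑ k ∈ Finset.range (n + 1), q ^ k * stirling2 n k

/-- `h_q(m)`: the number of permutations of `{1,…,m}` avoiding all patterns in `Pat(q)`. -/
noncomputable def hq (q m : ℕ) : ℕ :=
  Nat.card {π : Equiv.Perm (Fin m) // AvoidsPat q m (natPerm π)}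

/-- The number of cycles (including fixed points) of a permutation of `{1,…,n}`. -/
def cycleCount {n : ℕ} (σ : Equiv.Perm (Fin n)) : ℕ :=
  σ.cycleType.card + (n - σ.support.card)

/-- The signless Stirling number of the first kind `c(n,k)`: the number of permutations
of `{1,…,n}` with exactly `k` cycles. -/
noncomputable def stirling1 (n k : ℕ) : ℕ :=
  Nat.card {σ : Equiv.Perm (Fin n) // cycleCount σ = k}

lemma wordPerm_range'_reverse_inv_apply (p d x : ℕ) :
    (wordPerm (List.range' p d).reverse)⁻¹ x =
      if x = p + d then p else if p ≤ x ∧ x < p + d then x + 1 else x := by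
  induction d generalizing x with
  | zero =>
    simp only [List.range'_zero, List.reverse_nil, wordPerm, List.map_nil, List.prod_nil, inv_one,
      Equiv.Perm.one_apply]
    split_ifs <;> omega
  | succ d ih =>
    have h : wordPerm (List.range' p (d + 1)).reverse =
        sgen (p + d) * wordPerm (List.range' p d).reverse := by
      rw [List.range'_concat]
      simp [wordPerm]
    rw [h, mul_inv_rev, Equiv.Perm.mul_apply, ih, sgen, Equiv.swap_inv, Equiv.swap_apply_def]
    split_ifs <;> omega

lemma length_filter_le_range'_reverse (q p d : ℕ) :
    ((List.range' p d).reverse.filter fun j => q ≤ j).length = p + d - max p q := by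
  induction d with
  | zero => simp
  | succ d ih =>
    rw [List.range'_concat, List.reverse_append, List.filter_append, List.length_append, ih]
    by_cases h : q ≤ p + d <;> simp [h] <;> omega

lemma invQ_eq_sum_Ico (q m : ℕ) (π : Equiv.Perm ℕ) :
    invQ q m π = ∑ i ∈ Finset.Ico 1 (m + 1),
      min (i - q) ((Finset.Ico 1 i).filter fun j => π i < π j).card := by
  refine Finset.sum_subset (fun i hi => ?_) (fun i hi hni => ?_)
  · simp only [Finset.mem_Icc, Finset.mem_Ico] at *
    omega
  · simp only [Finset.mem_Icc, Finset.mem_Ico] at *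
    have : i - q = 0 := by omega
    simp [this]

lemma sum_Ico_eq_add_of_shift (f g : ℕ → ℕ) (q p m : ℕ) (hp : 1 ≤ p) (hpm : p ≤ m + 1)
    (hlt : ∀ i, 1 ≤ i → i < p → f i = g i) (heq : f p = 0)
    (hgt : ∀ i, p ≤ i → i ≤ m → f (i + 1) = g i + if q ≤ i then 1 else 0) :
    ∑ i ∈ Finset.Ico 1 (m + 2), f i =
      ∑ i ∈ Finset.Ico 1 (m + 1), g i + (m + 1 - max p q) := by
  have hcard : ∑ i ∈ Finset.Ico p (m + 1), (if q ≤ i then 1 else 0) = m + 1 - max p q := by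
    rw [← Finset.sum_filter, Finset.sum_const, smul_eq_mul, mul_one, ← Nat.card_Ico]
    congr 1
    ext i
    simp only [Finset.mem_filter, Finset.mem_Ico]
    omega
  rw [← Finset.sum_Ico_consecutive f hp (by omega : p ≤ m + 2),
    Finset.sum_eq_sum_Ico_succ_bot (by omega : p < m + 2), heq, zero_add,
    ← Finset.sum_Ico_add' f p (m + 1) 1, ← Finset.sum_Ico_consecutive g hp hpm, ← hcard,
    add_assoc, ← Finset.sum_add_distrib]
  congr 1
  · refine Finset.sum_congr rfl fun i hi => ?_
    rw [Finset.mem_Ico] at hi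
    exact hlt i hi.1 hi.2
  · refine Finset.sum_congr rfl fun i hi => ?_
    rw [Finset.mem_Ico] at hi
    exact hgt i hi.1 (by omega)

/-- Deleting the largest value `m + 1`, at position `p`, from the one-line notation of `π`
lowers `inv_q` by `m + 1 - max p q`. -/
lemma invQ_succ (q m p : ℕ) (π : Equiv.Perm ℕ)
    (hπ : ∀ k, k = 0 ∨ m + 1 < k → π k = k) (hp : 1 ≤ p) (hpm : p ≤ m + 1)
    (hmax : π p = m + 1) :
    invQ q (m + 1) π =
      invQ q m (π * (wordPerm (List.range' p (m + 1 - p)).reverse)⁻¹) + (m + 1 - max p q) := by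
  set c := wordPerm (List.range' p (m + 1 - p)).reverse with hc
  have hcinv : ∀ x, c⁻¹ x =
      if x = m + 1 then p else if p ≤ x ∧ x < m + 1 then x + 1 else x := by
    intro x
    rw [hc, wordPerm_range'_reverse_inv_apply, Nat.add_sub_cancel' hpm]
  have hle : ∀ i, i ≤ m + 1 → π i ≤ m + 1 := by
    intro i hi
    by_contra! h
    have := π.injective (hπ (π i) (Or.inr h))
    omega
  have hlt : ∀ i, i ≤ m + 1 → i ≠ p → π i < m + 1 := by
    intro i hi hip
    refine lt_of_le_of_ne (hle i hi) fun h => hip (π.injective (h.trans hmax.symm))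
  rw [invQ_eq_sum_Ico, invQ_eq_sum_Ico]
  refine sum_Ico_eq_add_of_shift _ _ q p m hp hpm (fun i hi hip => ?_) ?_ (fun i hpi him => ?_)
  · congr 2
    refine Finset.filter_congr fun j hj => ?_
    rw [Finset.mem_Ico] at hj
    have hi' : c⁻¹ i = i := by rw [hcinv]; split_ifs <;> omega
    have hj' : c⁻¹ j = j := by rw [hcinv]; split_ifs <;> omega
    rw [Equiv.Perm.mul_apply, Equiv.Perm.mul_apply, hi', hj']
  · rw [Finset.filter_false_of_mem, Finset.card_empty, Nat.min_zero]
    intro j hj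
    rw [Finset.mem_Ico] at hj
    rw [hmax, not_lt]
    exact hle j (by omega)
  · have hi' : c⁻¹ i = i + 1 := by rw [hcinv]; split_ifs <;> omega
    have hset : ((Finset.Ico 1 (i + 1)).filter fun j => π (i + 1) < π j).map c.toEmbedding =
        insert (m + 1) ((Finset.Ico 1 i).filter fun j => (π * c⁻¹) i < (π * c⁻¹) j) := by
      ext x
      have hx : c.symm x = c⁻¹ x := rfl
      have hlt' := hlt (i + 1) (by omega) (by omega)
      simp only [Finset.mem_map_equiv, Finset.mem_insert, Finset.mem_filter, Finset.mem_Ico,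
        Equiv.Perm.mul_apply, hi', hx]
      rw [hcinv x]
      by_cases h1 : x = m + 1
      · simp [h1, hmax]
        omega
      · by_cases h2 : p ≤ x ∧ x < m + 1
        · simp only [h1, h2, if_true, if_false, and_self, false_or]
          refine and_congr_left fun _ => ?_
          omega
        · simp only [h1, h2, if_false, false_or]
          refine and_congr_left fun _ => ?_
          omega
    have hcard := congrArg Finset.card hset
    rw [Finset.card_map, Finset.card_insert_of_notMem (by rw [Finset.mem_filter, Finset.mem_Ico]; omega)] at hcard
    rw [hcard]
    split_ifs <;> omega

lemma ellQ_eq_invQ (q m : ℕ) (π : Equiv.Perm ℕ) (hπ : ∀ k, k = 0 ∨ m < k → π k = k) :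
    ellQ q m π = invQ q m π := by
  induction m generalizing π with
  | zero => simp [ellQ, canonWord, invQ]
  | succ m ih =>
    obtain ⟨p, hp⟩ : ∃ p, p = π⁻¹ (m + 1) := ⟨_, rfl⟩
    have hmax : π p = m + 1 := by rw [hp]; exact π.apply_symm_apply _
    have hp1 : 1 ≤ p := by
      by_contra! h
      have := hπ p (Or.inl (by omega))
      omega
    have hpm : p ≤ m + 1 := by
      by_contra! h
      have := hπ p (Or.inr h)
      omega
    rw [invQ_succ q m p π hπ hp1 hpm hmax, ellQ, canonWord, ← hp, List.filter_append,
      List.length_append, length_filter_le_range'_reverse, Nat.add_sub_cancel' hpm]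
    congr 1
    refine ih _ fun k hk => ?_
    rw [Equiv.Perm.mul_apply, wordPerm_range'_reverse_inv_apply, Nat.add_sub_cancel' hpm]
    split_ifs with h1 h2
    · rw [hmax, h1]
    · omega
    · exact hπ k (by omega)

/-- Let `q` and `n` be positive integers. For every permutation `σ` of
`{1,…,n}`, the `q`-length equals the `q`-inversion number: `ℓ_q(σ) = inv_q(σ)`. -/
theorem q_length_eq_q_inversion (q n : ℕ) (hq : 0 < q) (hn : 0 < n)
    (σ : Equiv.Perm (Fin n)) :
    ellQ q n (natPerm σ) = invQ q n (natPerm σ) := by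
  refine ellQ_eq_invQ q n _ fun k hk => ?_
  refine Equiv.Perm.extendDomain_apply_not_subtype _ _ ?_
  rw [Finset.mem_Icc]
  omega
end

section
/- For every positive integer q and every permutation σ of {1,…,n}, the q-inversion number is invariant under inversion: inv_q(σ⁻¹) = inv_q(σ). -/
open Finset

/-- The number of positions `1 ≤ j < i` with `π(j) < π(i)`. -/
def nonInvCount (π : Equiv.Perm ℕ) (i : ℕ) : ℕ :=
  ((Finset.Ico 1 i).filter fun j => π j < π i).card

theorem nonInvCount_add_card_inv (π : Equiv.Perm ℕ) (i : ℕ) :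
    nonInvCount π i + ((Finset.Ico 1 i).filter fun j => π i < π j).card = i - 1 := by
  have hcard := Finset.card_filter_add_card_filter_not (s := Finset.Ico 1 i) (fun j => π j < π i)
  have hnot : ((Finset.Ico 1 i).filter fun j => ¬ π j < π i) =
      (Finset.Ico 1 i).filter fun j => π i < π j := by
    refine Finset.filter_congr fun j hj => ?_
    have hne : π j ≠ π i := fun h => (Finset.mem_Ico.1 hj).2.ne (π.injective h)
    omega
  rwa [hnot, Nat.card_Ico] at hcard

theorem invQ_add_sum_max (q m : ℕ) (hq : 0 < q) (π : Equiv.Perm ℕ) :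
    invQ q m π + ∑ i ∈ Finset.Icc 1 m, max (q - 1) (nonInvCount π i) =
      ∑ i ∈ Finset.Icc 1 m, max (q - 1) (i - 1) := by
  have hext : invQ q m π = ∑ i ∈ Finset.Icc 1 m,
      min (i - q) ((Finset.Ico 1 i).filter fun j => π i < π j).card := by
    refine Finset.sum_subset (Finset.Icc_subset_Icc_left (by omega)) fun i hi hi' => ?_
    simp only [Finset.mem_Icc] at hi hi'
    rw [show i - q = 0 by omega, Nat.zero_min]
  rw [hext, ← Finset.sum_add_distrib]
  refine Finset.sum_congr rfl fun i hi => ?_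
  have := nonInvCount_add_card_inv π i
  have := (Finset.mem_Icc.1 hi).1
  omega

theorem nonInvCount_inv_apply (π : Equiv.Perm ℕ) (h0 : π 0 = 0) (i : ℕ) :
    nonInvCount π⁻¹ (π i) = nonInvCount π i := by
  have hpos (j : ℕ) : 1 ≤ π j ↔ 1 ≤ j := by
    rw [Nat.one_le_iff_ne_zero, Nat.one_le_iff_ne_zero, ← h0, π.injective.ne_iff, h0]
  symm
  refine Finset.card_equiv π fun j => ?_
  simp only [Finset.mem_filter, Finset.mem_Ico, Equiv.Perm.inv_def, Equiv.symm_apply_apply, hpos]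
  tauto

theorem natPerm_inv {m : ℕ} (σ : Equiv.Perm (Fin m)) : natPerm σ⁻¹ = (natPerm σ)⁻¹ :=
  (Equiv.Perm.extendDomain_inv σ (finIccEquiv m)).symm

theorem natPerm_zero {m : ℕ} (σ : Equiv.Perm (Fin m)) : natPerm σ 0 = 0 :=
  Equiv.Perm.extendDomain_apply_not_subtype σ (finIccEquiv m) (by simp)

theorem natPerm_mem_Icc {m : ℕ} (σ : Equiv.Perm (Fin m)) {i : ℕ} (hi : i ∈ Finset.Icc 1 m) :
    natPerm σ i ∈ Finset.Icc 1 m := by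
  rw [natPerm, Equiv.Perm.extendDomain_apply_subtype σ (finIccEquiv m) hi]
  exact Subtype.property _

/-- For every positive integer `q` and every permutation `σ` of `{1,…,n}`,
the `q`-inversion number is invariant under inversion: `inv_q(σ⁻¹) = inv_q(σ)`. -/
theorem q_inversion_inv (q n : ℕ) (hq : 0 < q) (σ : Equiv.Perm (Fin n)) :
    invQ q n (natPerm σ⁻¹) = invQ q n (natPerm σ) := by
  have hsum : ∑ i ∈ Finset.Icc 1 n, max (q - 1) (nonInvCount (natPerm σ) i) =
      ∑ i ∈ Finset.Icc 1 n, max (q - 1) (nonInvCount (natPerm σ⁻¹) i) := by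
    refine Finset.sum_bij' (fun i _ => natPerm σ i) (fun i _ => natPerm σ⁻¹ i)
      (fun i hi => natPerm_mem_Icc σ hi) (fun i hi => natPerm_mem_Icc σ⁻¹ hi)
      (fun i _ => by simp [natPerm_inv]) (fun i _ => by simp [natPerm_inv]) fun i _ => ?_
    rw [natPerm_inv, nonInvCount_inv_apply _ (natPerm_zero σ)]
  have h₁ := invQ_add_sum_max q n hq (natPerm σ)
  have h₂ := invQ_add_sum_max q n hq (natPerm σ⁻¹)
  omega
end

section
/- For every permutation w of {1,…,n} and every positive integer q, the number of occurrences of the generator s_q in the canonical presentation of w equals the number of a^{q−1}.l.t.r.min of w: del_q(w) = #Del_q(w). -/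
open Finset

theorem wordPerm_reverse_range'_apply (p k i : ℕ) :
    wordPerm (List.range' p k).reverse i =
      if i = p then p + k else if p < i ∧ i ≤ p + k then i - 1 else i := by
  induction k with
  | zero => simp [wordPerm]; grind
  | succ k ih =>
    have h : wordPerm (List.range' p (k + 1)).reverse =
        sgen (p + k) * wordPerm (List.range' p k).reverse := by
      simp [wordPerm, List.range'_concat]
    rw [h, Equiv.Perm.mul_apply, ih, sgen, Equiv.swap_apply_def]
    grind

/-- Deleting the maximal value `m + 1`, at position `p`, from a permutation `π` of `{1,…,m+1}`:
the result `ρ` satisfies `ρ ∘ c = π` for the cycle `c` moving `p` to the last position. -/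
theorem card_DelQ_succ {q m p : ℕ} (hq : 0 < q) (hp : 1 ≤ p) (hpm : p ≤ m + 1)
    {π ρ c : Equiv.Perm ℕ} (hρ : ∀ i, ρ (c i) = π i) (hπp : π p = m + 1)
    (hπle : ∀ i, 1 ≤ i → i ≤ m + 1 → π i ≤ m + 1)
    (hc : ∀ i, c i = if i = p then m + 1 else if p < i ∧ i ≤ m + 1 then i - 1 else i) :
    (DelQ q (m + 1) π).card = (DelQ q m ρ).card + if p ≤ q ∧ q ≤ m then 1 else 0 := by
  have count_eq : ∀ i, 1 ≤ i → i ≤ m + 1 → i ≠ p →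
      ((Ico 1 (c i)).filter fun j => ρ j < ρ (c i)).card =
        ((Ico 1 i).filter fun j => π j < π i).card := by
    intro i h1 hi hip
    rw [← card_map (s := (Ico 1 i).filter fun j => π j < π i) c.toEmbedding]
    congr 1
    ext j
    obtain ⟨j, rfl⟩ := c.surjective j
    have hle := hπle i h1 hi
    have hjp : j = p → π j = m + 1 := by rintro rfl; exact hπp
    simp only [mem_filter, mem_Ico, hρ, mem_map_equiv, Equiv.symm_apply_apply]
    rw [hc i, hc j]
    clear hρ hc hπle
    grind
  have count_le : ∀ i, ((Ico 1 i).filter fun j => ρ j < ρ i).card ≤ i - 1 := fun i =>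
    (card_filter_le _ _).trans (by simp)
  have count_p : ((Ico 1 p).filter fun j => π j < π p).card = p - 1 := by
    rw [filter_true_of_mem, Nat.card_Ico]
    intro j hj
    rw [mem_Ico] at hj
    have hne : π j ≠ π p := fun h => by have := π.injective h; omega
    have := hπle j hj.1 (by omega)
    omega
  have hmap : (DelQ q (m + 1) π).map c.toEmbedding =
      DelQ q m ρ ∪ if p ≤ q ∧ q ≤ m then {q} else ∅ := by
    ext j
    obtain ⟨i, rfl⟩ := c.surjective j
    have hci := hc i
    have hmem : c i ∈ (if p ≤ q ∧ q ≤ m then {q} else ∅ : Finset ℕ) ↔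
        (p ≤ q ∧ q ≤ m) ∧ c i = q := by
      split_ifs with h <;> simp [h]
    rw [mem_union, hmem]
    simp only [DelQ, mem_filter, mem_Icc, mem_map_equiv, Equiv.symm_apply_apply]
    by_cases hip : i = p
    · subst hip
      rw [count_p]
      rw [if_pos rfl] at hci
      omega
    · rw [if_neg hip] at hci
      by_cases hi : 1 ≤ i ∧ i ≤ m + 1
      · have := count_le (c i)
        rw [count_eq i hi.1 hi.2 hip] at this ⊢
        split_ifs at hci <;> omega
      · rw [if_neg (by omega)] at hci
        omega
  rw [← card_map c.toEmbedding, hmap, card_union_of_disjoint]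
  · split_ifs <;> simp
  · split_ifs <;> simp [DelQ]

theorem delq_eq_card_DelQ_of_fixed {q : ℕ} (hq : 0 < q) (m : ℕ) (π : Equiv.Perm ℕ)
    (h0 : π 0 = 0) (hπ : ∀ i, m < i → π i = i) : delq q m π = (DelQ q m π).card := by
  induction m generalizing π with
  | zero => simp [delq, canonWord, DelQ]
  | succ m ih =>
    have hπp : π (π⁻¹ (m + 1)) = m + 1 := by simp
    have hword : delq q (m + 1) π =
        delq q m (π * (wordPerm
          (List.range' (π⁻¹ (m + 1)) (m + 1 - π⁻¹ (m + 1))).reverse)⁻¹) +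
        (List.range' (π⁻¹ (m + 1)) (m + 1 - π⁻¹ (m + 1))).reverse.count q := by
      simp only [delq, canonWord, List.count_append]
    rw [hword]
    generalize π⁻¹ (m + 1) = p at *
    have hp : 1 ≤ p := by
      by_contra h
      obtain rfl : p = 0 := by omega
      omega
    have hpm : p ≤ m + 1 := by
      by_contra h
      have := hπ p (by omega)
      omega
    have hc := wordPerm_reverse_range'_apply p (m + 1 - p)
    rw [Nat.add_sub_cancel' hpm] at hc
    have hcount : (List.range' p (m + 1 - p)).reverse.count q =
        if p ≤ q ∧ q ≤ m then 1 else 0 := by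
      rw [List.count_reverse, (List.nodup_range').count]
      simp only [List.mem_range'_1]
      grind
    rw [hcount]
    generalize wordPerm (List.range' p (m + 1 - p)).reverse = c at hc
    have hρ : ∀ i, (π * c⁻¹) (c i) = π i := fun i => by simp
    have hπle : ∀ i, 1 ≤ i → i ≤ m + 1 → π i ≤ m + 1 := by
      intro i _ hi
      by_contra h
      have := π.injective (hπ (π i) (by omega))
      omega
    rw [card_DelQ_succ hq hp hpm hρ hπp hπle hc, ih]
    · have := hρ 0
      rwa [hc, if_neg (by omega), if_neg (by omega), h0] at this
    · intro i hi
      obtain rfl | hi' := eq_or_ne i (m + 1)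
      · have := hρ p
        rwa [hc, if_pos rfl, hπp] at this
      · have := hρ i
        rwa [hc, if_neg (by omega), if_neg (by omega), hπ i (by omega)] at this

/-- For every permutation `w` of `{1,…,n}` and every positive integer `q`,
the number of occurrences of the generator `s_q` in the canonical presentation of `w` equals
the number of `a^{q-1}.l.t.r.min` of `w`: `del_q(w) = #Del_q(w)`. -/
theorem delq_eq_card_DelQ (q n : ℕ) (hq : 0 < q) (w : Equiv.Perm (Fin n)) :
    delq q n (natPerm w) = (DelQ q n (natPerm w)).card := by
  have hfix : ∀ i, i ∉ Finset.Icc 1 n → natPerm w i = i := fun i hi =>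
    Equiv.Perm.extendDomain_apply_not_subtype _ _ hi
  exact delq_eq_card_DelQ_of_fixed hq n _ (hfix 0 (by simp))
    fun i hi => hfix i (by rw [mem_Icc]; omega)
end

section
/- Let q and n be positive integers. For every π ∈ S_{n+q−1}: (1) Del_q(π) − (q−1) = Del_1(f_q(π)), and in particular #Del_q(π) = #Del_1(f_q(π)); (2) Des_q(π) − (q−1) = Des_1(f_q(π)), and in particular #Des_q(π) = #Des_1(f_q(π)); (3) inv_q(π) = inv_1(f_q(π)). Here X − r := {i − r : i ∈ X} for a set X of integers. -/
open Finset

/-- The permutation `π` of `ℕ` moves only points of `{1,…,m}`. -/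
def SupportedUpTo (m : ℕ) (π : Equiv.Perm ℕ) : Prop :=
  ∀ x, x = 0 ∨ m < x → π x = x

/-- The number of positions before `i` that carry a value larger than `π i`. -/
def invAt (π : Equiv.Perm ℕ) (i : ℕ) : ℕ :=
  ((Finset.Ico 1 i).filter fun j => π i < π j).card

/-- The number of positions before `i` that carry a value smaller than `π i`. -/
def coinvAt (π : Equiv.Perm ℕ) (i : ℕ) : ℕ :=
  ((Finset.Ico 1 i).filter fun j => π j < π i).card

/-- The factor `s_{p+k-1} ⋯ s_{p+1} s_p` of a canonical presentation. -/
def descendingCycle (p k : ℕ) : Equiv.Perm ℕ :=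
  wordPerm (List.range' p k).reverse

theorem SupportedUpTo.mono {m m' : ℕ} {π : Equiv.Perm ℕ} (h : SupportedUpTo m π)
    (hm : m ≤ m') : SupportedUpTo m' π := fun x hx => h x (by omega)

theorem SupportedUpTo.apply_le {m x : ℕ} {π : Equiv.Perm ℕ} (h : SupportedUpTo m π)
    (hx : x ≤ m) : π x ≤ m := by
  by_contra! hlt
  have := π.injective (h (π x) (Or.inr hlt))
  omega

theorem supportedUpTo_natPerm {m : ℕ} (π : Equiv.Perm (Fin m)) :
    SupportedUpTo m (natPerm π) := by
  intro x hx
  refine Equiv.Perm.extendDomain_apply_not_subtype _ _ ?_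
  simp only [Finset.mem_Icc]
  omega

theorem coinvAt_add_invAt (π : Equiv.Perm ℕ) (i : ℕ) :
    coinvAt π i + invAt π i = i - 1 := by
  have h := Finset.card_filter_add_card_filter_not (s := Finset.Ico 1 i) fun j => π j < π i
  rw [Nat.card_Ico] at h
  rw [← h, coinvAt, invAt]
  congr 2
  refine Finset.filter_congr fun j hj => ?_
  have : π j ≠ π i := fun e => by
    have := π.injective e
    simp only [Finset.mem_Ico] at hj
    omega
  omega

theorem invAt_lt_invAt_succ_iff (π : Equiv.Perm ℕ) {i : ℕ} (hi : 1 ≤ i) :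
    invAt π i < invAt π (i + 1) ↔ π (i + 1) < π i := by
  constructor
  · intro h
    by_contra! hle
    refine absurd h (not_lt.2 (Finset.card_le_card fun j => ?_))
    simp only [Finset.mem_filter, Finset.mem_Ico]
    rintro ⟨⟨h1, h2⟩, h3⟩
    have : j ≠ i := by rintro rfl; omega
    omega
  · intro h
    refine Finset.card_lt_card ((Finset.ssubset_iff_of_subset fun j => ?_).2 ⟨i, ?_, ?_⟩)
    · simp only [Finset.mem_filter, Finset.mem_Ico]
      omega
    · simp only [Finset.mem_filter, Finset.mem_Ico]
      omega
    · simp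

theorem descendingCycle_apply (p k x : ℕ) :
    descendingCycle p k x =
      if x = p then p + k else if p < x ∧ x ≤ p + k then x - 1 else x := by
  induction k with
  | zero =>
    simp only [descendingCycle, wordPerm, List.range'_zero, List.reverse_nil, List.map_nil,
      List.prod_nil, Equiv.Perm.one_apply]
    grind
  | succ k ih =>
    have h : descendingCycle p (k + 1) = sgen (p + k) * descendingCycle p k := by
      simp [descendingCycle, wordPerm, List.range'_concat]
    rw [h, Equiv.Perm.mul_apply, ih, sgen, Equiv.swap_apply_def]
    grind

theorem SupportedUpTo.mul_descendingCycle {p k : ℕ} {σ : Equiv.Perm ℕ}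
    (hσ : SupportedUpTo (p + k) σ) (hp : 1 ≤ p) :
    SupportedUpTo (p + k) (σ * descendingCycle p k) := by
  intro x hx
  have : descendingCycle p k x = x := by
    rw [descendingCycle_apply]
    grind
  rw [Equiv.Perm.mul_apply, this, hσ x hx]

theorem invAt_mul_descendingCycle_of_lt {p k i : ℕ} (σ : Equiv.Perm ℕ) (hi : i < p) :
    invAt (σ * descendingCycle p k) i = invAt σ i := by
  have h : ∀ x < p, descendingCycle p k x = x := fun x hx => by
    rw [descendingCycle_apply]
    grind
  unfold invAt
  congr 1
  refine Finset.filter_congr fun j hj => ?_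
  simp only [Finset.mem_Ico] at hj
  rw [Equiv.Perm.mul_apply, Equiv.Perm.mul_apply, h i hi, h j (by omega)]

theorem invAt_mul_descendingCycle_self {p k m : ℕ} {σ : Equiv.Perm ℕ}
    (hσ : SupportedUpTo m σ) (hm : m + 1 = p + k) :
    invAt (σ * descendingCycle p k) p = 0 := by
  refine Finset.card_eq_zero.2 (Finset.filter_eq_empty_iff.2 fun j hj => ?_)
  simp only [Finset.mem_Ico] at hj
  have h1 : descendingCycle p k p = m + 1 := by simp [descendingCycle_apply, hm]
  have h2 : descendingCycle p k j = j := by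
    rw [descendingCycle_apply]
    grind
  rw [Equiv.Perm.mul_apply, Equiv.Perm.mul_apply, h1, h2, hσ (m + 1) (by omega)]
  have := hσ.apply_le (x := j) (by omega)
  omega

theorem invAt_mul_descendingCycle_of_gt {p k m i : ℕ} {σ : Equiv.Perm ℕ}
    (hσ : SupportedUpTo m σ) (hm : m + 1 = p + k) (hp : 1 ≤ p) (hpi : p < i)
    (hi : i ≤ m + 1) :
    invAt (σ * descendingCycle p k) i = invAt σ (i - 1) + 1 := by
  set g : ℕ → ℕ := fun x => if x < p then x else x + 1 with hg
  have hginj : Function.Injective g := fun x y h => by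
    simp only [hg] at h
    grind
  have hcg : ∀ x ≤ m, descendingCycle p k (g x) = x := fun x hx => by
    rw [descendingCycle_apply]
    simp only [hg]
    grind
  have hcp : descendingCycle p k p = m + 1 := by simp [descendingCycle_apply, hm]
  have hci : descendingCycle p k i = i - 1 := by
    rw [descendingCycle_apply]
    grind
  have hset : ((Finset.Ico 1 i).filter fun j =>
      (σ * descendingCycle p k) i < (σ * descendingCycle p k) j) =
      insert p (((Finset.Ico 1 (i - 1)).filter fun j => σ (i - 1) < σ j).image g) := by
    ext j
    simp only [Finset.mem_filter, Finset.mem_insert, Finset.mem_image, Finset.mem_Ico,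
      Equiv.Perm.mul_apply, hci]
    constructor
    · rintro ⟨hj, hlt⟩
      by_cases hjp : j = p
      · exact Or.inl hjp
      · right
        obtain ⟨x, rfl, hx1, hx2⟩ : ∃ x, g x = j ∧ 1 ≤ x ∧ x < i - 1 := by
          by_cases hlt' : j < p
          · exact ⟨j, by simp [hg, hlt'], by omega, by omega⟩
          · refine ⟨j - 1, ?_, by omega, by omega⟩
            simp only [hg]
            grind
        rw [hcg x (by omega)] at hlt
        exact ⟨x, ⟨⟨hx1, hx2⟩, hlt⟩, rfl⟩
    · rintro (rfl | ⟨x, ⟨⟨hx1, hx2⟩, hlt⟩, rfl⟩)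
      · refine ⟨by omega, ?_⟩
        rw [hcp, hσ (m + 1) (by omega)]
        have := hσ.apply_le (x := i - 1) (by omega)
        omega
      · rw [hcg x (by omega)]
        refine ⟨?_, hlt⟩
        simp only [hg]
        grind
  unfold invAt
  rw [hset, Finset.card_insert_of_notMem, Finset.card_image_of_injective _ hginj]
  simp only [Finset.mem_image, not_exists, not_and, hg]
  grind

theorem filter_map_range' (q p k : ℕ) :
    ((List.range' p k).filter fun j => q ≤ j).map (fun j => j - q + 1) =
      List.range' (max p q + 1 - q) (p + k - max p q) := by
  induction k with
  | zero => simp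
  | succ k ih =>
    rw [List.range'_concat, List.filter_append, List.map_append, ih]
    by_cases h : q ≤ p + k
    · rw [show p + (k + 1) - max p q = p + k - max p q + 1 by omega, List.range'_concat]
      simp [h]
      omega
    · rw [show p + (k + 1) - max p q = 0 by omega, show p + k - max p q = 0 by omega]
      simp [h]

theorem fq_succ (q m : ℕ) (π : Equiv.Perm ℕ) (hp : π⁻¹ (m + 1) ≤ m + 1) :
    fq q (m + 1) π =
      fq q m (π * (descendingCycle (π⁻¹ (m + 1)) (m + 1 - π⁻¹ (m + 1)))⁻¹) *
        descendingCycle (max (π⁻¹ (m + 1)) q + 1 - q) (m + 1 - max (π⁻¹ (m + 1)) q) := by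
  have h := filter_map_range' q (π⁻¹ (m + 1)) (m + 1 - π⁻¹ (m + 1))
  rw [Nat.add_sub_cancel' hp] at h
  unfold fq descendingCycle
  rw [canonWord, List.filter_append, List.map_append, List.filter_reverse, List.map_reverse, h]
  simp [wordPerm]

theorem fq_supported_and_invAt {q : ℕ} (hq : 0 < q) (m : ℕ) (π : Equiv.Perm ℕ)
    (hπ : SupportedUpTo m π) :
    SupportedUpTo (m + 1 - q) (fq q m π) ∧
      ∀ i, q ≤ i → i ≤ m → invAt (fq q m π) (i + 1 - q) = min (i - q) (invAt π i) := by
  induction m generalizing π with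
  | zero =>
    refine ⟨fun x _ => ?_, fun i _ _ => by omega⟩
    simp [fq, canonWord, wordPerm]
  | succ m ih =>
    obtain ⟨p, hp⟩ : ∃ p, p = π⁻¹ (m + 1) := ⟨_, rfl⟩
    have hπp : π p = m + 1 := by simp [hp]
    have hp1 : 1 ≤ p := by
      by_contra! h0
      have := hπ p (by omega)
      omega
    have hpm : p ≤ m + 1 := by
      by_contra! h0
      have := hπ p (by omega)
      omega
    have hf := fq_succ q m π (hp ▸ hpm)
    rw [← hp] at hf
    obtain ⟨k, hk⟩ : ∃ k, m + 1 = p + k := ⟨m + 1 - p, by omega⟩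
    rw [show m + 1 - p = k by omega] at hf
    set σ := π * (descendingCycle p k)⁻¹ with hσdef
    have hπσ : π = σ * descendingCycle p k := by simp [hσdef]
    have hcp : descendingCycle p k p = m + 1 := by simp [descendingCycle_apply, hk]
    have hσ : SupportedUpTo m σ := by
      intro x hx
      by_cases hxm : x = m + 1
      · have : (descendingCycle p k)⁻¹ (m + 1) = p := Equiv.Perm.inv_eq_iff_eq.2 hcp.symm
        rw [hxm, hσdef, Equiv.Perm.mul_apply, this, hπp]
      · have hcx : descendingCycle p k x = x := by
          rw [descendingCycle_apply]
          grind
        have : (descendingCycle p k)⁻¹ x = x := Equiv.Perm.inv_eq_iff_eq.2 hcx.symm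
        rw [hσdef, Equiv.Perm.mul_apply, this, hπ x (by omega)]
    obtain ⟨hS, hI⟩ := ih σ hσ
    set τ := fq q m σ
    rw [hf]
    by_cases hqm : m + 1 ≤ q
    · rw [show m + 1 - max p q = 0 by omega]
      have h1 : descendingCycle (max p q + 1 - q) 0 = 1 := by simp [descendingCycle, wordPerm]
      rw [h1, mul_one]
      refine ⟨hS.mono (by omega), fun i hi1 hi2 => ?_⟩
      rw [show i + 1 - q = 1 by omega, show i - q = 0 by omega]
      simp [invAt]
    obtain ⟨r, hr⟩ : ∃ r, r = max p q + 1 - q := ⟨_, rfl⟩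
    obtain ⟨l, hl⟩ : ∃ l, l = m + 1 - max p q := ⟨_, rfl⟩
    have hrl : m + 1 - q + 1 = r + l := by omega
    rw [← hr, ← hl]
    constructor
    · have := (hS.mono (m' := r + l) (by omega)).mul_descendingCycle (by omega)
      rwa [← hrl, show m + 1 - q + 1 = m + 1 + 1 - q by omega] at this
    intro i hi1 hi2
    rcases hi1.eq_or_lt with rfl | hqi
    · rw [show q + 1 - q = 1 by omega, Nat.sub_self]
      simp [invAt]
    rw [hπσ]
    rcases lt_trichotomy i p with hip | rfl | hip
    · rw [invAt_mul_descendingCycle_of_lt _ hip,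
        invAt_mul_descendingCycle_of_lt _ (by omega), hI i hi1 (by omega)]
    · rw [invAt_mul_descendingCycle_self hσ hk, show i + 1 - q = r by omega,
        invAt_mul_descendingCycle_self hS hrl]
      simp
    · rw [invAt_mul_descendingCycle_of_gt hσ hk hp1 hip hi2,
        invAt_mul_descendingCycle_of_gt hS hrl (by omega) (by omega) (by omega)]
      have := hI (i - 1) (by omega) (by omega)
      rw [show i - 1 + 1 - q = i + 1 - q - 1 by omega] at this
      omega

theorem mem_DelQ {q m i : ℕ} {π : Equiv.Perm ℕ} (hq : 0 < q) :
    i ∈ DelQ q m π ↔ (q + 1 ≤ i ∧ i ≤ m) ∧ i - q ≤ invAt π i := by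
  have h := coinvAt_add_invAt π i
  change _ ∈ Finset.filter (fun i => coinvAt π i ≤ q - 1) _ ↔ _
  simp only [Finset.mem_filter, Finset.mem_Icc]
  omega

theorem mem_DesQ {q m i : ℕ} {π : Equiv.Perm ℕ} (hq : 0 < q) :
    i ∈ DesQ q m π ↔
      (q ≤ i ∧ i + 1 ≤ m) ∧ (invAt π i < invAt π (i + 1) ∨ i + 1 - q ≤ invAt π (i + 1)) := by
  simp only [DesQ, DesSet, Finset.mem_union, Finset.mem_inter, Finset.mem_filter,
    Finset.mem_Icc, Finset.mem_image, mem_DelQ hq]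
  constructor
  · rintro (⟨⟨h1, h2⟩, h3⟩ | ⟨j, h1, rfl⟩)
    · rw [invAt_lt_invAt_succ_iff π (by omega)]
      exact ⟨by omega, Or.inl h2⟩
    · rw [Nat.sub_add_cancel (by omega)]
      exact ⟨by omega, Or.inr (by omega)⟩
  · rintro ⟨h1, h2 | h2⟩
    · rw [invAt_lt_invAt_succ_iff π (by omega)] at h2
      exact Or.inl ⟨⟨by omega, h2⟩, by omega⟩
    · exact Or.inr ⟨i + 1, ⟨by omega, h2⟩, by omega⟩

theorem image_sub_eq_and_card_eq {A B : Finset ℕ} {r : ℕ} (hA : ∀ i ∈ A, r ≤ i)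
    (h : ∀ i, i + r ∈ A ↔ i ∈ B) :
    A.image (fun i => i - r) = B ∧ A.card = B.card := by
  have himage : A.image (fun i => i - r) = B := by
    ext i
    rw [← h i, Finset.mem_image]
    constructor
    · rintro ⟨j, hj, rfl⟩
      rwa [Nat.sub_add_cancel (hA j hj)]
    · exact fun hi => ⟨i + r, hi, by omega⟩
  refine ⟨himage, ?_⟩
  rw [← himage, Finset.card_image_of_injOn]
  intro i hi j hj hij
  have := hA i hi
  have := hA j hj
  simp only at hij
  omega

/-- Let `q` and `n` be positive integers. For every `π ∈ S_{n+q-1}`: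
(1) `Del_q(π) - (q-1) = Del_1(f_q(π))`, in particular `#Del_q(π) = #Del_1(f_q(π))`;
(2) `Des_q(π) - (q-1) = Des_1(f_q(π))`, in particular `#Des_q(π) = #Des_1(f_q(π))`;
(3) `inv_q(π) = inv_1(f_q(π))`. -/
theorem covering_map_statistics (q n : ℕ) (hq : 0 < q) (hn : 0 < n)
    (π : Equiv.Perm (Fin (n + q - 1))) :
    ((DelQ q (n + q - 1) (natPerm π)).image (fun i => i - (q - 1)) =
        DelQ 1 n (fq q (n + q - 1) (natPerm π)) ∧
      (DelQ q (n + q - 1) (natPerm π)).card =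
        (DelQ 1 n (fq q (n + q - 1) (natPerm π))).card) ∧
    ((DesQ q (n + q - 1) (natPerm π)).image (fun i => i - (q - 1)) =
        DesQ 1 n (fq q (n + q - 1) (natPerm π)) ∧
      (DesQ q (n + q - 1) (natPerm π)).card =
        (DesQ 1 n (fq q (n + q - 1) (natPerm π))).card) ∧
    invQ q (n + q - 1) (natPerm π) = invQ 1 n (fq q (n + q - 1) (natPerm π)) := by
  have hinv := (fq_supported_and_invAt hq _ _ (supportedUpTo_natPerm π)).2
  set σ := fq q (n + q - 1) (natPerm π)
  set ρ := natPerm π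
  have hshift : ∀ i, 1 ≤ i → i ≤ n → invAt σ i = min (i - 1) (invAt ρ (i + (q - 1))) := by
    intro i h1 h2
    have := hinv (i + (q - 1)) (by omega) (by omega)
    rwa [show i + (q - 1) + 1 - q = i by omega, show i + (q - 1) - q = i - 1 by omega] at this
  refine ⟨image_sub_eq_and_card_eq ?_ ?_, image_sub_eq_and_card_eq ?_ ?_, ?_⟩
  · intro i hi
    rw [mem_DelQ hq] at hi
    omega
  · intro i
    rw [mem_DelQ hq, mem_DelQ one_pos]
    have := hshift i
    omega
  · intro i hi
    rw [mem_DesQ hq] at hi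
    omega
  · intro i
    rw [mem_DesQ hq, mem_DesQ one_pos, show i + (q - 1) + 1 = i + 1 + (q - 1) by omega]
    have := hshift i
    have := hshift (i + 1)
    omega
  · change ∑ i ∈ _, min (i - q) (invAt ρ i) = ∑ i ∈ _, min (i - 1) (invAt σ i)
    symm
    refine Finset.sum_bij (fun i _ => i + (q - 1)) ?_ ?_ ?_ ?_
    · intro i hi
      simp only [Finset.mem_Icc] at hi ⊢
      omega
    · intro i _ j _ hij
      omega
    · intro j hj
      simp only [Finset.mem_Icc] at hj
      exact ⟨j - (q - 1), Finset.mem_Icc.2 (by omega), by omega⟩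
    · intro i hi
      simp only [Finset.mem_Icc] at hi
      have := hshift i (by omega) (by omega)
      omega
end

section
/- Let q and n be positive integers. For every π ∈ S_n, the fiber of the covering map f_q : S_{n+q−1} → S_n over π has cardinality #f_q^{−1}(π) = q! · q^{#Del_1(π)} = (q−1)! · q^{#Del_1(π)+1}. -/
open Finset

/-- `π` fixes every point outside `{1,…,m}`. -/
def FixesOutside (m : ℕ) (π : Equiv.Perm ℕ) : Prop :=
  ∀ i, i ∉ Finset.Icc 1 m → π i = i

/-- The element `s_{m-1} s_{m-2} ⋯ s_k` of `R_{m-1}`; it is trivial for `k ≥ m`. -/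
def descCycle (m k : ℕ) : Equiv.Perm ℕ := wordPerm (List.range' k (m - k)).reverse

open scoped Classical in
/-- The positions of all left-to-right minima of a permutation of `{1,…,m}`,
including the first position. -/
noncomputable def lrMin (m : ℕ) (π : Equiv.Perm ℕ) : Finset ℕ :=
  (Finset.Icc 1 m).filter fun i => ∀ j ∈ Finset.Ico 1 i, π i < π j

theorem mem_lrMin {m : ℕ} {π : Equiv.Perm ℕ} {i : ℕ} :
    i ∈ lrMin m π ↔ (1 ≤ i ∧ i ≤ m) ∧ ∀ j, 1 ≤ j → j < i → π i < π j := by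
  simp [lrMin]

theorem wordPerm_append (L M : List ℕ) : wordPerm (L ++ M) = wordPerm L * wordPerm M := by
  simp [wordPerm]

theorem descCycle_apply (k d i : ℕ) :
    descCycle (k + d) k i =
      if i = k then k + d else if k < i ∧ i ≤ k + d then i - 1 else i := by
  induction d generalizing i with
  | zero =>
    have : ¬ (k < i ∧ i ≤ k + 0) := by omega
    simp only [this, if_false]
    split_ifs <;> simp_all [descCycle, wordPerm]
  | succ d ih =>
    have h : descCycle (k + (d + 1)) k = sgen (k + d) * descCycle (k + d) k := by
      simp [descCycle, wordPerm, List.range'_concat]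
    rw [h, Equiv.Perm.mul_apply, ih, sgen, Equiv.swap_apply_def]
    split_ifs <;> omega

theorem descCycle_apply_of_le {k m : ℕ} (h : k ≤ m) (i : ℕ) :
    descCycle m k i = if i = k then m else if k < i ∧ i ≤ m then i - 1 else i := by
  obtain ⟨d, rfl⟩ := Nat.exists_eq_add_of_le h
  exact descCycle_apply k d i

theorem FixesOutside.mul {m : ℕ} {σ τ : Equiv.Perm ℕ} (hσ : FixesOutside m σ)
    (hτ : FixesOutside m τ) : FixesOutside m (σ * τ) := fun i hi => by
  rw [Equiv.Perm.mul_apply, hτ i hi, hσ i hi]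

theorem FixesOutside.inv {m : ℕ} {σ : Equiv.Perm ℕ} (hσ : FixesOutside m σ) :
    FixesOutside m σ⁻¹ := fun i hi => by
  rw [Equiv.Perm.inv_eq_iff_eq, hσ i hi]

theorem FixesOutside.mono {m m' : ℕ} (h : m ≤ m') {σ : Equiv.Perm ℕ} (hσ : FixesOutside m σ) :
    FixesOutside m' σ := fun i hi => hσ i (by simp only [Finset.mem_Icc] at *; omega)

theorem FixesOutside.apply_mem {m : ℕ} {σ : Equiv.Perm ℕ} (hσ : FixesOutside m σ) {i : ℕ}
    (hi : i ∈ Finset.Icc 1 m) : σ i ∈ Finset.Icc 1 m := by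
  by_contra h
  exact h ((σ.injective (hσ _ h)).symm ▸ hi)

theorem fixesOutside_descCycle {k m : ℕ} (hk : 1 ≤ k) (hm : k ≤ m) :
    FixesOutside m (descCycle m k) := fun i hi => by
  rw [Finset.mem_Icc] at hi
  rw [descCycle_apply_of_le hm]
  split_ifs <;> omega

theorem FixesOutside.of_succ {m : ℕ} {σ : Equiv.Perm ℕ} (hσ : FixesOutside (m + 1) σ)
    (h : σ (m + 1) = m + 1) : FixesOutside m σ := fun i hi => by
  by_cases him : i = m + 1
  · rw [him, h]
  · exact hσ i (by simp only [Finset.mem_Icc] at *; omega)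

theorem inv_apply_mul_descCycle {m k : ℕ} {σ : Equiv.Perm ℕ} (hσ : FixesOutside m σ)
    (hk : k ≤ m + 1) : (σ * descCycle (m + 1) k)⁻¹ (m + 1) = k := by
  rw [Equiv.Perm.inv_eq_iff_eq, Equiv.Perm.mul_apply, descCycle_apply_of_le hk, if_pos rfl,
    hσ _ (by simp)]

theorem mul_descCycle_inj {m k l : ℕ} {σ τ : Equiv.Perm ℕ} (hσ : FixesOutside m σ)
    (hτ : FixesOutside m τ) (hk : k ≤ m + 1) (hl : l ≤ m + 1) :
    σ * descCycle (m + 1) k = τ * descCycle (m + 1) l ↔ σ = τ ∧ k = l := by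
  refine ⟨fun h => ?_, fun h => by rw [h.1, h.2]⟩
  have hkl : k = l := by
    rw [← inv_apply_mul_descCycle hσ hk, h, inv_apply_mul_descCycle hτ hl]
  subst hkl
  exact ⟨mul_right_cancel h, rfl⟩

theorem FixesOutside.exists_eq_mul_descCycle {m : ℕ} {σ : Equiv.Perm ℕ}
    (hσ : FixesOutside (m + 1) σ) :
    ∃ τ k, FixesOutside m τ ∧ 1 ≤ k ∧ k ≤ m + 1 ∧ σ = τ * descCycle (m + 1) k := by
  have hk := hσ.inv.apply_mem (i := m + 1) (by simp)
  rw [Finset.mem_Icc] at hk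
  refine ⟨σ * (descCycle (m + 1) (σ⁻¹ (m + 1)))⁻¹, σ⁻¹ (m + 1), ?_, hk.1, hk.2, by simp⟩
  refine (hσ.mul (fixesOutside_descCycle hk.1 hk.2).inv).of_succ ?_
  have : (descCycle (m + 1) (σ⁻¹ (m + 1)))⁻¹ (m + 1) = σ⁻¹ (m + 1) := by
    rw [Equiv.Perm.inv_eq_iff_eq, descCycle_apply_of_le hk.2, if_pos rfl]
  rw [Equiv.Perm.mul_apply, this]
  exact σ.apply_symm_apply _

theorem canonWord_mul_descCycle {m k : ℕ} {σ : Equiv.Perm ℕ} (hσ : FixesOutside m σ)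
    (hk : k ≤ m + 1) :
    canonWord (m + 1) (σ * descCycle (m + 1) k) =
      canonWord m σ ++ (List.range' k (m + 1 - k)).reverse := by
  rw [canonWord, inv_apply_mul_descCycle hσ hk]
  change canonWord m (σ * descCycle (m + 1) k * (descCycle (m + 1) k)⁻¹) ++ _ = _
  rw [mul_inv_cancel_right]

theorem lt_of_mem_canonWord {m j : ℕ} {σ : Equiv.Perm ℕ} (h : j ∈ canonWord m σ) : j < m := by
  induction m generalizing σ with
  | zero => simp [canonWord] at h
  | succ m ih =>
    rw [canonWord, List.mem_append, List.mem_reverse, List.mem_range'_1] at h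
    rcases h with h | h
    · exact (ih h).trans (Nat.lt_succ_self m)
    · omega

theorem map_filter_range' (r k d : ℕ) :
    ((List.range' k d).filter fun j => r + 1 ≤ j).map (fun j => j - (r + 1) + 1) =
      List.range' (max (k - r) 1) (k + d - r - max (k - r) 1) := by
  induction d with
  | zero =>
    have : k + 0 - r - max (k - r) 1 = 0 := by omega
    rw [this]
    rfl
  | succ d ih =>
    rw [List.range'_concat, List.filter_append, List.map_append, ih]
    by_cases h : r + 1 ≤ k + d
    · have h1 : k + (d + 1) - r - max (k - r) 1 = k + d - r - max (k - r) 1 + 1 := by omega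
      have h2 : k + d - (r + 1) + 1 = max (k - r) 1 + (k + d - r - max (k - r) 1) := by omega
      rw [h1, List.range'_concat, List.filter_cons_of_pos (by simpa using h)]
      simp [h2]
    · have h1 : k + (d + 1) - r - max (k - r) 1 = k + d - r - max (k - r) 1 := by omega
      rw [h1, List.filter_cons_of_neg (by simpa using h)]
      simp

theorem fq_mul_descCycle {n r k : ℕ} {σ : Equiv.Perm ℕ} (hσ : FixesOutside (n + r) σ)
    (hk : k ≤ n + r + 1) :
    fq (r + 1) (n + r + 1) (σ * descCycle (n + r + 1) k) =
      fq (r + 1) (n + r) σ * descCycle (n + 1) (max (k - r) 1) := by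
  have h : k + (n + r + 1 - k) - r - max (k - r) 1 = n + 1 - max (k - r) 1 := by omega
  rw [fq, canonWord_mul_descCycle hσ hk, List.filter_append, List.map_append, wordPerm_append,
    List.filter_reverse, List.map_reverse, map_filter_range', h]
  rfl

theorem fq_eq_one (r : ℕ) (σ : Equiv.Perm ℕ) : fq (r + 1) r σ = 1 := by
  have : (canonWord r σ).filter (fun j => r + 1 ≤ j) = [] := by
    rw [List.filter_eq_nil_iff]
    intro j hj
    have := lt_of_mem_canonWord hj
    simp only [decide_eq_true_eq]
    omega
  rw [fq, this]
  rfl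

theorem fixesOutside_fq {n r : ℕ} {σ : Equiv.Perm ℕ} (hσ : FixesOutside (n + r) σ) :
    FixesOutside n (fq (r + 1) (n + r) σ) := by
  induction n generalizing σ with
  | zero => rw [Nat.zero_add, fq_eq_one]; exact fun _ _ => rfl
  | succ n ih =>
    rw [Nat.add_right_comm] at hσ ⊢
    obtain ⟨τ, k, hτ, -, hk, rfl⟩ := hσ.exists_eq_mul_descCycle
    rw [fq_mul_descCycle hτ hk]
    exact ((ih hτ).mono n.le_succ).mul (fixesOutside_descCycle (by omega) (by omega))

theorem natPerm_injective (m : ℕ) : Function.Injective (natPerm (m := m)) :=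
  Equiv.Perm.extendDomainHom_injective (finIccEquiv m)

theorem range_natPerm (m : ℕ) : Set.range (natPerm (m := m)) = {σ | FixesOutside m σ} := by
  ext σ
  constructor
  · rintro ⟨π, rfl⟩ i hi
    exact Equiv.Perm.extendDomain_apply_not_subtype _ _ hi
  · intro hσ
    have hmem : ∀ i, σ i ∈ Finset.Icc 1 m ↔ i ∈ Finset.Icc 1 m := fun i =>
      ⟨fun h => by simpa using hσ.inv.apply_mem h, fun h => hσ.apply_mem h⟩
    refine ⟨(finIccEquiv m).permCongr.symm (σ.subtypePerm hmem), ?_⟩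
    ext i
    by_cases hi : i ∈ Finset.Icc 1 m
    · rw [natPerm, Equiv.Perm.extendDomain_apply_subtype _ _ hi]
      simp [Equiv.permCongr]
    · rw [natPerm, Equiv.Perm.extendDomain_apply_not_subtype _ _ hi]
      exact (hσ i hi).symm

theorem ncard_fixesOutside (m : ℕ) : {σ | FixesOutside m σ}.ncard = m.factorial := by
  rw [← range_natPerm, ← Set.image_univ, Set.ncard_image_of_injective _ (natPerm_injective m),
    Set.ncard_univ, Nat.card_eq_fintype_card, Fintype.card_perm, Fintype.card_fin]

theorem card_lrMin_mul_descCycle_one {n : ℕ} {σ : Equiv.Perm ℕ} (hσ : FixesOutside n σ) :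
    (lrMin (n + 1) (σ * descCycle (n + 1) 1)).card = (lrMin n σ).card + 1 := by
  have h : lrMin (n + 1) (σ * descCycle (n + 1) 1) =
      insert 1 ((lrMin n σ).map (addRightEmbedding 1)) := by
    ext i
    simp only [mem_lrMin, Finset.mem_insert, Finset.mem_map, addRightEmbedding_apply,
      Equiv.Perm.mul_apply, descCycle_apply_of_le (Nat.le_add_left 1 n)]
    constructor
    · rintro ⟨⟨h1, h2⟩, h3⟩
      rcases Nat.eq_or_lt_of_le h1 with h1 | h1
      · exact Or.inl h1.symm
      · refine Or.inr ⟨i - 1, ⟨⟨by omega, by omega⟩, fun j hj hji => ?_⟩, by omega⟩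
        have := h3 (j + 1) (by omega) (by omega)
        rwa [if_neg (by omega), if_pos (by omega), if_neg (by omega), if_pos (by omega),
          Nat.add_sub_cancel] at this
    · rintro (rfl | ⟨i, ⟨⟨h1, h2⟩, h3⟩, rfl⟩)
      · exact ⟨by omega, fun j _ _ => by omega⟩
      · refine ⟨by omega, fun j hj hji => ?_⟩
        rw [if_neg (by omega), if_pos (by omega), Nat.add_sub_cancel]
        by_cases hj1 : j = 1
        · have := hσ.apply_mem (Finset.mem_Icc.2 ⟨h1, h2⟩)
          rw [Finset.mem_Icc] at this
          rw [if_pos hj1, hσ (n + 1) (by simp)]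
          omega
        · rw [if_neg hj1, if_pos (by omega)]
          exact h3 _ (by omega) (by omega)
  rw [h, Finset.card_insert_of_notMem, Finset.card_map]
  simp [mem_lrMin]

theorem card_lrMin_mul_descCycle {n p : ℕ} {σ : Equiv.Perm ℕ} (hσ : FixesOutside n σ)
    (hp : 1 < p) (hpn : p ≤ n + 1) :
    (lrMin (n + 1) (σ * descCycle (n + 1) p)).card = (lrMin n σ).card := by
  have hinj : Function.Injective fun i => if i < p then i else i + 1 := fun a b h => by
    dsimp only at h
    split_ifs at h <;> omega
  have hval : ∀ i, 1 ≤ i → i ≤ n →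
      (σ * descCycle (n + 1) p) (if i < p then i else i + 1) = σ i := fun i _ _ => by
    rw [Equiv.Perm.mul_apply, descCycle_apply_of_le hpn]
    congr 1
    split_ifs <;> omega
  have hmax : (σ * descCycle (n + 1) p) p = n + 1 := by
    rw [Equiv.Perm.mul_apply, descCycle_apply_of_le hpn, if_pos rfl, hσ _ (by simp)]
  have hle : ∀ i, 1 ≤ i → i ≤ n → σ i ≤ n := fun i h1 h2 =>
    (Finset.mem_Icc.1 (hσ.apply_mem (Finset.mem_Icc.2 ⟨h1, h2⟩))).2
  have hsurj : ∀ i, i ≠ p → 1 ≤ i → i ≤ n + 1 →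
      ∃ j, 1 ≤ j ∧ j ≤ n ∧ (if j < p then j else j + 1) = i := fun i hi h1 h2 => by
    by_cases hip : i < p
    · exact ⟨i, h1, by omega, if_pos hip⟩
    · exact ⟨i - 1, by omega, by omega, by rw [if_neg (by omega)]; omega⟩
  have h : lrMin (n + 1) (σ * descCycle (n + 1) p) =
      (lrMin n σ).image fun i => if i < p then i else i + 1 := by
    ext i
    simp only [Finset.mem_image, mem_lrMin]
    constructor
    · rintro ⟨⟨h1, h2⟩, h3⟩
      have hip : i ≠ p := by
        rintro rfl
        have h4 := h3 1 le_rfl hp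
        have h5 := hval 1 le_rfl (by omega)
        rw [if_pos hp] at h5
        rw [hmax, h5] at h4
        have := hle 1 le_rfl (by omega)
        omega
      obtain ⟨j, hj1, hjn, rfl⟩ := hsurj i hip h1 h2
      refine ⟨j, ⟨⟨hj1, hjn⟩, fun l hl hlj => ?_⟩, rfl⟩
      rw [← hval j hj1 hjn, ← hval l hl (by omega)]
      exact h3 _ (by split_ifs <;> omega) (by split_ifs <;> omega)
    · rintro ⟨j, ⟨⟨h1, h2⟩, h3⟩, rfl⟩
      refine ⟨by split_ifs <;> omega, fun l hl hlj => ?_⟩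
      rw [hval j h1 h2]
      by_cases hlp : l = p
      · have := hle j h1 h2
        rw [hlp, hmax]
        omega
      · have hln : l ≤ n + 1 := by split_ifs at hlj <;> omega
        obtain ⟨l, hl1, hl2, rfl⟩ := hsurj l hlp hl hln
        rw [hval l hl1 hl2]
        exact h3 l hl1 (by split_ifs at hlj <;> omega)
  rw [h, Finset.card_image_of_injective _ hinj]

theorem card_lrMin {n : ℕ} (hn : 0 < n) (σ : Equiv.Perm ℕ) :
    (lrMin n σ).card = (DelQ 1 n σ).card + 1 := by
  have h : lrMin n σ = insert 1 (DelQ 1 n σ) := by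
    ext i
    simp only [mem_lrMin, DelQ, Finset.mem_insert, Finset.mem_filter, Finset.mem_Icc, tsub_self,
      Nat.le_zero, Finset.card_eq_zero, Finset.filter_eq_empty_iff, Finset.mem_Ico, not_lt, and_imp]
    constructor
    · rintro ⟨h1, h2⟩
      by_cases hi : i = 1
      · exact Or.inl hi
      · exact Or.inr ⟨by omega, fun j hj hji => (h2 j hj hji).le⟩
    · rintro (rfl | ⟨h1, h2⟩)
      · exact ⟨by omega, fun j _ _ => by omega⟩
      · exact ⟨by omega, fun j hj hji =>
          (h2 hj hji).lt_of_ne fun h => hji.ne (σ.injective h).symm⟩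
  rw [h, Finset.card_insert_of_notMem]
  simp [DelQ]

theorem fiber_mul_descCycle {n r p : ℕ} {π : Equiv.Perm ℕ} (hπ : FixesOutside n π)
    (hp : p ≤ n + 1) :
    {σ | FixesOutside (n + r + 1) σ ∧
        fq (r + 1) (n + r + 1) σ = π * descCycle (n + 1) p}.ncard =
      {σ | FixesOutside (n + r) σ ∧ fq (r + 1) (n + r) σ = π}.ncard *
        ((Finset.Icc 1 (n + r + 1)).filter fun k => max (k - r) 1 = p).card := by
  rw [← Set.ncard_coe_finset, ← Set.ncard_prod,
    ← Set.InjOn.ncard_image (f := fun x : Equiv.Perm ℕ × ℕ => x.1 * descCycle (n + r + 1) x.2)]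
  · congr 1
    ext σ
    simp only [Set.mem_ofPred_eq, Set.mem_image, Set.mem_prod, Prod.exists, Finset.mem_coe,
      Finset.mem_filter, Finset.mem_Icc]
    constructor
    · rintro ⟨hσ, h⟩
      obtain ⟨τ, k, hτ, hk1, hk, rfl⟩ := hσ.exists_eq_mul_descCycle
      rw [fq_mul_descCycle hτ hk,
        mul_descCycle_inj (fixesOutside_fq hτ) hπ (by omega) hp] at h
      exact ⟨τ, k, ⟨⟨hτ, h.1⟩, ⟨hk1, hk⟩, h.2⟩, rfl⟩
    · rintro ⟨τ, k, ⟨⟨hτ, h⟩, ⟨hk1, hk⟩, rfl⟩, rfl⟩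
      exact ⟨(hτ.mono (Nat.le_succ _)).mul (fixesOutside_descCycle hk1 hk),
        by rw [fq_mul_descCycle hτ hk, h]⟩
  · rintro ⟨σ, k⟩ ⟨⟨hσ, -⟩, hk⟩ ⟨τ, l⟩ ⟨⟨hτ, -⟩, hl⟩ h
    simp only [Finset.coe_filter, Finset.mem_Icc, Set.mem_ofPred_eq] at hk hl
    exact Prod.ext_iff.2 ((mul_descCycle_inj hσ hτ hk.1.2 hl.1.2).1 h)

theorem ncard_fq_fiber (n r : ℕ) {π : Equiv.Perm ℕ} (hπ : FixesOutside n π) :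
    {σ | FixesOutside (n + r) σ ∧ fq (r + 1) (n + r) σ = π}.ncard =
      r.factorial * (r + 1) ^ (lrMin n π).card := by
  induction n generalizing π with
  | zero =>
    have h1 : π = 1 := Equiv.ext fun i => hπ i (by simp)
    have h2 : lrMin 0 π = ∅ := by simp [lrMin]
    simp [h1 ▸ h2, h1, fq_eq_one, ncard_fixesOutside]
  | succ n ih =>
    obtain ⟨τ, p, hτ, hp1, hp, rfl⟩ := hπ.exists_eq_mul_descCycle
    rw [Nat.add_right_comm, fiber_mul_descCycle hτ hp, ih hτ]
    rcases Nat.eq_or_lt_of_le hp1 with rfl | hp1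
    · have : (Finset.Icc 1 (n + r + 1)).filter (fun k => max (k - r) 1 = 1) =
          Finset.Icc 1 (r + 1) := by
        ext k
        simp only [Finset.mem_filter, Finset.mem_Icc]
        omega
      rw [this, Nat.card_Icc, card_lrMin_mul_descCycle_one hτ, pow_succ, mul_assoc,
        Nat.add_sub_cancel]
    · have : (Finset.Icc 1 (n + r + 1)).filter (fun k => max (k - r) 1 = p) = {p + r} := by
        ext k
        simp only [Finset.mem_filter, Finset.mem_Icc, Finset.mem_singleton]
        omega
      rw [this, Finset.card_singleton, mul_one, card_lrMin_mul_descCycle hτ hp1 hp]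

/-- Let `q` and `n` be positive integers. For every `π ∈ S_n`, the fiber of
the covering map `f_q : S_{n+q-1} → S_n` over `π` has cardinality
`#f_q⁻¹(π) = q! · q^{#Del_1(π)} = (q-1)! · q^{#Del_1(π)+1}`. -/
theorem fiber_card (q n : ℕ) (hq : 0 < q) (hn : 0 < n) (π : Equiv.Perm (Fin n)) :
    {σ : Equiv.Perm (Fin (n + q - 1)) |
        fq q (n + q - 1) (natPerm σ) = natPerm π}.ncard =
      Nat.factorial q * q ^ (DelQ 1 n (natPerm π)).card ∧
    Nat.factorial q * q ^ (DelQ 1 n (natPerm π)).card =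
      Nat.factorial (q - 1) * q ^ ((DelQ 1 n (natPerm π)).card + 1) := by
  obtain ⟨r, rfl⟩ := Nat.exists_eq_add_of_le' hq
  have hfac : (r + 1).factorial * (r + 1) ^ (DelQ 1 n (natPerm π)).card =
      (r + 1 - 1).factorial * (r + 1) ^ ((DelQ 1 n (natPerm π)).card + 1) := by
    rw [Nat.add_sub_cancel, Nat.factorial_succ]
    ring
  refine ⟨?_, hfac⟩
  have hπ : FixesOutside n (natPerm π) :=
    (range_natPerm n).subset (Set.mem_range_self π)
  rw [hfac, Nat.add_sub_cancel, ← card_lrMin hn, ← ncard_fq_fiber n r hπ,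
    ← Set.ncard_image_of_injective _ (natPerm_injective _)]
  change (natPerm '' (natPerm ⁻¹' {σ | fq (r + 1) (n + r) σ = natPerm π})).ncard = _
  rw [Set.image_preimage_eq_range_inter, range_natPerm]
  rfl
end

section
/- Let q and n be positive integers. A permutation π ∈ S_{n+q−1} avoids Pat(q) if and only if Del_q(π) − 1 = Des_q(π); that is, Avoid_q(n+q−1) = {π ∈ S_{n+q−1} : Del_q(π) − 1 = Des_q(π)}. -/
open Finset

/-- A pattern of `Pat(q)` ending at `d` can be read off from the number of entries before
position `d` that are smaller than the descent bottom `π (d + 1)`. -/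
theorem avoidsPat_iff_card_lt (q m : ℕ) (π : Equiv.Perm ℕ) :
    AvoidsPat q m π ↔ ∀ d, 1 ≤ d → d < m → π (d + 1) < π d →
      ((Finset.Ico 1 (d + 1)).filter fun j => π j < π (d + 1)).card < q := by
  constructor
  · intro h d hd hdm hdes
    by_contra! hcard
    obtain ⟨T, hT, hTq⟩ := Finset.exists_subset_card_eq hcard
    have hTlt : ∀ j ∈ T, 1 ≤ j ∧ j < d ∧ π j < π (d + 1) := by
      intro j hj
      have hj' := hT hj
      simp only [Finset.mem_filter, Finset.mem_Ico] at hj'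
      have hne : j ≠ d := by
        rintro rfl
        omega
      omega
    have hdT : d ∉ T := fun hd => (hTlt d hd).2.1.false
    have hS : (insert d T).card = q + 1 := by rw [Finset.card_insert_of_notMem hdT, hTq]
    set f := (insert d T).orderEmbOfFin hS with hf
    have hmem : ∀ a, f a ∈ insert d T := fun a => Finset.orderEmbOfFin_mem _ hS a
    have hlast : f (Fin.last q) = d := by
      obtain ⟨a, ha⟩ : d ∈ Set.range f := by
        rw [hf, Finset.range_orderEmbOfFin]
        simp
      have hle : f a ≤ f (Fin.last q) := f.monotone (Fin.le_last a)
      rcases Finset.mem_insert.1 (hmem (Fin.last q)) with h1 | h1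
      · exact h1
      · have := (hTlt _ h1).2.1
        omega
    refine h ⟨f, f.strictMono, ?_, ?_, ?_, fun a ha => ?_⟩
    · rcases Finset.mem_insert.1 (hmem 0) with h0 | h0
      · omega
      · exact (hTlt _ h0).1
    · rwa [hlast]
    · rwa [hlast]
    · rw [hlast]
      rcases Finset.mem_insert.1 (hmem a) with h1 | h1
      · exact absurd (f.injective (h1.trans hlast.symm)) ha
      · exact (hTlt _ h1).2.2
  · rintro h ⟨f, hf, h0, hm, hdes, hlt⟩
    have hpos : ∀ a, 1 ≤ f a := fun a => h0.trans (hf.monotone (Fin.zero_le a))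
    refine (h _ (hpos _) hm hdes).not_ge ?_
    calc q = (Finset.univ.image (f ∘ Fin.castSucc : Fin q → ℕ)).card := by
          rw [Finset.card_image_of_injective _
            (hf.injective.comp (Fin.castSucc_injective q)), Finset.card_fin]
      _ ≤ _ := by
          refine Finset.card_le_card fun j hj => ?_
          obtain ⟨a, -, rfl⟩ := Finset.mem_image.1 hj
          have hlast : f a.castSucc < f (Fin.last q) := hf (Fin.castSucc_lt_last a)
          exact Finset.mem_filter.2 ⟨Finset.mem_Ico.2 ⟨hpos _, hlast.trans (Nat.lt_succ_self _)⟩,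
            hlt _ (Fin.castSucc_lt_last a).ne⟩

theorem mem_image_delQ_iff {q m : ℕ} (hq : 0 < q) (π : Equiv.Perm ℕ) (d : ℕ) :
    d ∈ (DelQ q m π).image (fun i => i - 1) ↔ q ≤ d ∧ d < m ∧
      ((Finset.Ico 1 (d + 1)).filter fun j => π j < π (d + 1)).card < q := by
  simp only [DelQ, Finset.mem_image, Finset.mem_filter, Finset.mem_Icc]
  constructor
  · rintro ⟨i, ⟨hi, hc⟩, rfl⟩
    obtain ⟨k, rfl⟩ : ∃ k, i = k + 1 := ⟨i - 1, by omega⟩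
    rw [Nat.add_sub_cancel]
    omega
  · rintro ⟨h1, h2, h3⟩
    exact ⟨d + 1, by omega, by omega⟩

theorem avoidsPat_iff_image_delQ_eq_desQ {q : ℕ} (hq : 0 < q) (m : ℕ) (π : Equiv.Perm ℕ) :
    AvoidsPat q m π ↔ (DelQ q m π).image (fun i => i - 1) = DesQ q m π := by
  rw [DesQ, eq_comm, Finset.union_eq_right, avoidsPat_iff_card_lt]
  simp only [Finset.subset_iff, mem_image_delQ_iff hq, DesSet, Finset.mem_inter,
    Finset.mem_filter, Finset.mem_Icc]
  constructor
  · rintro h d ⟨⟨hd, hdes⟩, hqd⟩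
    exact ⟨hqd.1, by omega, h d hd.1 (by omega) hdes⟩
  · intro h d hd hdm hdes
    by_cases hqd : q ≤ d
    · exact (h ⟨⟨⟨hd, by omega⟩, hdes⟩, hqd, by omega⟩).2.2
    · have hcard := Finset.card_filter_le (Finset.Ico 1 (d + 1)) fun j => π j < π (d + 1)
      rw [Nat.card_Ico] at hcard
      omega

/-- Let `q` and `n` be positive integers. A permutation `π ∈ S_{n+q-1}`
avoids `Pat(q)` if and only if `Del_q(π) - 1 = Des_q(π)`. -/
theorem avoids_iff_del_eq_des (q n : ℕ) (hq : 0 < q) (hn : 0 < n)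
    (π : Equiv.Perm (Fin (n + q - 1))) :
    AvoidsPat q (n + q - 1) (natPerm π) ↔
      (DelQ q (n + q - 1) (natPerm π)).image (fun i => i - 1) =
        DesQ q (n + q - 1) (natPerm π) :=
  avoidsPat_iff_image_delQ_eq_desQ hq _ _
end

section
/- For all positive integers q and n with n ≥ q, the numbers of Pat(q)-avoiding permutations satisfy the recurrence h_q(n) = q · Σ_{k=0}^{n−q} C(n−q, k) · h_q(n−k−1). -/
open Finset

/-- A word `l` is `q`-good if every descent `x > y` of adjacent letters of `l` has fewer than `q`
letters smaller than `y` to its left. -/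
def GoodWord (q : ℕ) (l : List ℕ) : Prop :=
  ∀ a x y b, l = a ++ x :: y :: b → y < x → (a.filter (· < y)).length < q

open Classical in
/-- The `q`-good words using each letter of `A` exactly once. -/
noncomputable def goodWords (q : ℕ) (A : Finset ℕ) : Finset (List ℕ) :=
  A.toList.permutations.toFinset.filter (GoodWord q)

theorem mem_goodWords {q : ℕ} {A : Finset ℕ} {l : List ℕ} :
    l ∈ goodWords q A ↔ (l.Nodup ∧ ∀ x, x ∈ l ↔ x ∈ A) ∧ GoodWord q l := by
  have h : l.Perm A.toList ↔ l.Nodup ∧ ∀ x, x ∈ l ↔ x ∈ A := by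
    constructor
    · intro h
      exact ⟨h.nodup_iff.2 A.nodup_toList, fun x => by rw [h.mem_iff, Finset.mem_toList]⟩
    · rintro ⟨h1, h2⟩
      rw [List.perm_ext_iff_of_nodup h1 A.nodup_toList]
      simpa using h2
  simp [goodWords, h]

theorem goodWord_map_range {q m : ℕ} (g : ℕ → ℕ) :
    GoodWord q ((List.range m).map g) ↔
      ∀ i, i + 1 < m → g (i + 1) < g i → #{j ∈ Finset.range i | g j < g (i + 1)} < q := by
  have key : ∀ i y, (((List.range i).map g).filter (· < y)).length =
      #{j ∈ Finset.range i | g j < y} := by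
    intro i y
    rw [List.filter_map, List.length_map]
    rfl
  constructor
  · intro h i hi hlt
    rw [← key]
    refine h _ (g i) (g (i + 1)) (((List.range m).map g).drop (i + 2)) ?_ hlt
    apply List.ext_getElem
    · simp; omega
    · intro k h1 h2
      simp only [List.getElem_map, List.getElem_range]
      rcases lt_trichotomy k i with hk | rfl | hk
      · rw [List.getElem_append_left (by simpa using hk)]; simp
      · rw [List.getElem_append_right (by simp)]; simp
      · rw [List.getElem_append_right (by simp; omega)]
        simp only [List.length_map, List.length_range]
        obtain ⟨d, rfl⟩ := Nat.exists_eq_add_of_lt hk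
        rcases d with _ | d
        · simp
        · simp [show i + (d + 1) + 1 - i = d + 2 by omega]
          congr 1; omega
  · intro h a x y b hl hlt
    have hlen := congrArg List.length hl
    simp only [List.length_map, List.length_range, List.length_append, List.length_cons] at hlen
    have ha : a = (List.range a.length).map g := by
      have := congrArg (List.take a.length) hl
      rw [List.take_left, ← List.map_take, List.take_range] at this
      rw [← this]; simp
    have hx : x = g a.length := by
      have := congrArg (fun l => l[a.length]?) hl
      simp [List.getElem?_range (show a.length < m by omega)] at this
      exact this.symm
    have hy : y = g (a.length + 1) := by
      have := congrArg (fun l => l[a.length + 1]?) hl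
      simp [List.getElem?_range (show a.length + 1 < m by omega)] at this
      exact this.symm
    have := h a.length (by omega) (by rw [← hx, ← hy]; exact hlt)
    rw [ha, key, hy]
    exact this

theorem avoidsPat_iff {q m : ℕ} (π : Equiv.Perm ℕ) :
    AvoidsPat q m π ↔ ∀ i, i + 1 < m → π (i + 1 + 1) < π (i + 1) →
      #{j ∈ Finset.range i | π (j + 1) < π (i + 1 + 1)} < q := by
  unfold AvoidsPat
  constructor
  · intro h i hi hlt
    by_contra! hc
    obtain ⟨T, hT, hTc⟩ := Finset.exists_subset_card_eq hc
    have hmem : ∀ a, T.orderEmbOfFin hTc a < i ∧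
        π (T.orderEmbOfFin hTc a + 1) < π (i + 1 + 1) := fun a => by
      simpa using hT (T.orderEmbOfFin_mem hTc a)
    refine h ⟨Fin.snoc (α := fun _ => ℕ) (fun a => T.orderEmbOfFin hTc a + 1) (i + 1),
      ?_, ?_, ?_, ?_, ?_⟩
    · intro a b hab
      induction b using Fin.lastCases with
      | last =>
        induction a using Fin.lastCases with
        | last => exact absurd hab (lt_irrefl _)
        | cast a => simpa using (hmem a).1
      | cast b =>
        induction a using Fin.lastCases with
        | last => exact absurd hab (not_lt.2 (Fin.le_last _))
        | cast a => simpa using hab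
    · generalize (0 : Fin (q + 1)) = z
      induction z using Fin.lastCases <;> simp
    · simpa using hi
    · simpa using hlt
    · intro a ha
      induction a using Fin.lastCases with
      | last => exact absurd rfl ha
      | cast a => simpa using (hmem a).2
  · rintro h ⟨f, hf, h0, hm, hd, hs⟩
    have h1 : ∀ a, 1 ≤ f a := fun a => h0.trans (hf.monotone (Fin.zero_le a))
    obtain ⟨i, hi⟩ := Nat.exists_eq_add_of_le' (h1 (Fin.last q))
    rw [hi] at hm hd hs
    refine absurd (h i hm hd) (not_lt.2 ?_)
    calc q = #(Finset.univ : Finset (Fin q)) := by simp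
      _ ≤ _ := by
        refine Finset.card_le_card_of_injOn (fun a => f a.castSucc - 1) ?_ ?_
        · intro a _
          have := hf (Fin.castSucc_lt_last a)
          have h1a := h1 a.castSucc
          simp only [Finset.coe_filter, Finset.mem_range, Set.mem_ofPred_eq]
          refine ⟨by omega, ?_⟩
          rw [Nat.sub_add_cancel h1a]
          exact hs _ (Fin.castSucc_lt_last a).ne
        · intro a _ b _ hab
          have h1a := h1 a.castSucc
          have h1b := h1 b.castSucc
          simp only at hab
          exact Fin.castSucc_injective _ (hf.injective (by omega))

theorem natPerm_apply {m : ℕ} (π : Equiv.Perm (Fin m)) (i : Fin m) :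
    natPerm π (i + 1) = π i + 1 :=
  π.extendDomain_apply_image (finIccEquiv m) i

/-- The word of a permutation, with letters renamed increasingly to the elements of `A`. -/
noncomputable def permWord (A : Finset ℕ) (π : Equiv.Perm (Fin #A)) : List ℕ :=
  (List.range #A).map fun i => Nat.nth (· ∈ A) (natPerm π (i + 1) - 1)

theorem finite_mem_toFinset_card (A : Finset ℕ) (hf : {x | x ∈ A}.Finite) :
    #hf.toFinset = #A := by
  congr 1; ext; simp

theorem nth_mem_lt_iff {A : Finset ℕ} {a b : ℕ} (ha : a < #A) (hb : b < #A) :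
    Nat.nth (· ∈ A) a < Nat.nth (· ∈ A) b ↔ a < b := by
  have hf : {x | x ∈ A}.Finite := A.finite_toSet
  have := Nat.nth_strictMonoOn hf
  rw [finite_mem_toFinset_card] at this
  exact this.lt_iff_lt ha hb

theorem nth_mem_inj {A : Finset ℕ} {a b : ℕ} (ha : a < #A) (hb : b < #A)
    (h : Nat.nth (· ∈ A) a = Nat.nth (· ∈ A) b) : a = b := by
  have h1 := nth_mem_lt_iff ha hb
  have h2 := nth_mem_lt_iff hb ha
  omega

theorem permWord_eq_ofFn (A : Finset ℕ) (π : Equiv.Perm (Fin #A)) :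
    permWord A π = List.ofFn fun i => Nat.nth (· ∈ A) (π i) := by
  apply List.ext_getElem
  · simp [permWord]
  · intro k h1 h2
    have hk : k < #A := by simpa using h2
    have := natPerm_apply π ⟨k, hk⟩
    simp only at this
    simp [permWord, this]

theorem goodWord_permWord {q : ℕ} {A : Finset ℕ} {π : Equiv.Perm (Fin #A)} :
    GoodWord q (permWord A π) ↔ AvoidsPat q #A (natPerm π) := by
  have key : ∀ i j, i < #A → j < #A →
      (Nat.nth (· ∈ A) (natPerm π (i + 1) - 1) < Nat.nth (· ∈ A) (natPerm π (j + 1) - 1) ↔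
        natPerm π (i + 1) < natPerm π (j + 1)) := by
    intro i j hi hj
    have h1 := natPerm_apply π ⟨i, hi⟩
    have h2 := natPerm_apply π ⟨j, hj⟩
    simp only at h1 h2
    rw [h1, h2, nth_mem_lt_iff (by simp) (by simp)]
    simp
  rw [permWord, goodWord_map_range, avoidsPat_iff]
  refine forall_congr' fun i => forall_congr' fun hi => ?_
  rw [key _ _ hi (by omega)]
  refine forall_congr' fun _ => ?_
  rw [Finset.filter_congr fun j hj => key j (i + 1) ?_ hi]
  have := Finset.mem_range.1 hj
  omega

theorem permWord_injective (A : Finset ℕ) : Function.Injective (permWord A) := by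
  intro π σ h
  rw [permWord_eq_ofFn, permWord_eq_ofFn] at h
  ext i
  exact nth_mem_inj (by simp) (by simp) (congrFun (List.ofFn_injective h) i)

theorem exists_permWord {A : Finset ℕ} {l : List ℕ} (hl : l.Nodup)
    (hA : ∀ x, x ∈ l ↔ x ∈ A) : ∃ π, permWord A π = l := by
  have hlen : l.length = #A := by
    rw [← List.toFinset_card_of_nodup hl]
    congr 1; ext; simp [hA]
  have hf : {x | x ∈ A}.Finite := A.finite_toSet
  have hex : ∀ i : Fin #A, ∃ k : Fin #A, Nat.nth (· ∈ A) k = l[(i : ℕ)] := by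
    intro i
    obtain ⟨k, hk, hk'⟩ := Nat.exists_lt_card_finite_nth_eq hf
      ((hA _).1 (List.getElem_mem (by omega : (i : ℕ) < l.length)))
    rw [finite_mem_toFinset_card] at hk
    exact ⟨⟨k, hk⟩, hk'⟩
  choose f hf using hex
  have hinj : Function.Injective f := by
    intro i j hij
    have := (hf i).symm.trans ((congrArg (fun k : Fin #A => Nat.nth (· ∈ A) k) hij).trans (hf j))
    exact Fin.ext ((hl.getElem_inj_iff).1 this)
  refine ⟨Equiv.ofBijective f (Finite.injective_iff_bijective.1 hinj), ?_⟩
  rw [permWord_eq_ofFn]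
  apply List.ext_getElem
  · simp [hlen]
  · intro k h1 h2
    simpa using hf ⟨k, by omega⟩

theorem permWord_nodup (A : Finset ℕ) (π : Equiv.Perm (Fin #A)) :
    (permWord A π).Nodup := by
  rw [permWord_eq_ofFn, List.nodup_ofFn]
  intro i j h
  exact π.injective (Fin.ext (nth_mem_inj (by simp) (by simp) h))

theorem mem_permWord {A : Finset ℕ} {π : Equiv.Perm (Fin #A)} {x : ℕ} :
    x ∈ permWord A π ↔ x ∈ A := by
  have hf : {x | x ∈ A}.Finite := A.finite_toSet
  rw [permWord_eq_ofFn, List.mem_ofFn']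
  constructor
  · rintro ⟨i, rfl⟩
    exact Nat.nth_mem_of_lt_card hf (by rw [finite_mem_toFinset_card]; simp)
  · intro hx
    obtain ⟨k, hk, hk'⟩ := Nat.exists_lt_card_finite_nth_eq hf hx
    rw [finite_mem_toFinset_card] at hk
    exact ⟨π.symm ⟨k, hk⟩, by simpa using hk'⟩

theorem card_goodWords (q : ℕ) (A : Finset ℕ) : #(goodWords q A) = hq q #A := by
  rw [hq, ← Nat.card_eq_finsetCard]
  have hmem (π : {π : Equiv.Perm (Fin #A) // AvoidsPat q #A (natPerm π)}) :
      permWord A π.1 ∈ goodWords q A :=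
    mem_goodWords.2 ⟨⟨permWord_nodup A _, fun _ => mem_permWord⟩,
      goodWord_permWord.2 π.2⟩
  refine (Nat.card_congr (Equiv.ofBijective (fun π => ⟨_, hmem π⟩) ⟨?_, ?_⟩)).symm
  · intro π σ h
    exact Subtype.ext (permWord_injective A (congrArg Subtype.val h))
  · rintro ⟨l, hl⟩
    obtain ⟨⟨h1, h2⟩, h3⟩ := mem_goodWords.1 hl
    obtain ⟨π, rfl⟩ := exists_permWord h1 h2
    exact ⟨⟨π, goodWord_permWord.1 h3⟩, rfl⟩

theorem exists_split_last_lt {q : ℕ} {l : List ℕ} (h : ∃ x ∈ l, x < q) :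
    ∃ a v s, l = a ++ v :: s ∧ v < q ∧ ∀ x ∈ s, q ≤ x := by
  induction l with
  | nil => simp at h
  | cons y l ih =>
    by_cases h' : ∃ x ∈ l, x < q
    · obtain ⟨a, v, s, rfl, hv, hs⟩ := ih h'
      exact ⟨y :: a, v, s, rfl, hv, hs⟩
    · push Not at h'
      obtain ⟨x, hx, hxq⟩ := h
      rcases List.mem_cons.1 hx with rfl | hx
      · exact ⟨[], x, l, rfl, hxq, h'⟩
      · exact absurd hxq (not_lt.2 (h' x hx))

theorem split_last_lt_unique {q v v' : ℕ} {a a' s s' : List ℕ}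
    (h : a ++ v :: s = a' ++ v' :: s') (hv : v < q) (hv' : v' < q)
    (hs : ∀ x ∈ s, q ≤ x) (hs' : ∀ x ∈ s', q ≤ x) : a = a' ∧ v = v' ∧ s = s' := by
  rcases List.append_eq_append_iff.1 h with ⟨c, rfl, hc⟩ | ⟨c, rfl, hc⟩ <;>
    rcases c with _ | ⟨d, c⟩
  · simpa using hc
  · have := hs v' (by simp_all)
    omega
  · simpa [eq_comm] using hc
  · have := hs' v (by simp_all)
    omega

theorem GoodWord.of_append {q : ℕ} {a b : List ℕ} (h : GoodWord q (a ++ b)) : GoodWord q a :=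
  fun c x y d hd => h c x y (d ++ b) (by simp [hd])

theorem GoodWord.isChain {q v : ℕ} {a s : List ℕ} (h : GoodWord q (a ++ v :: s))
    (hnd : (a ++ v :: s).Nodup) (hs : ∀ x ∈ s, q ≤ x) (hall : ∀ x < q, x ∈ a ++ v :: s) :
    (v :: s).IsChain (· < ·) := by
  rw [List.isChain_iff_forall_rel_of_append_cons_cons]
  intro x y b c hbc
  have hy : y ∈ s := by
    rcases b with _ | ⟨d, b⟩ <;> simp at hbc <;> simp [hbc]
  have hc : ∀ z ∈ c, q ≤ z := fun z hz => hs z <| by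
    rcases b with _ | ⟨d, b⟩ <;> simp at hbc <;> simp [hbc, hz]
  by_contra! hyx
  rw [hbc] at h hnd hall
  have hne : y ≠ x := by rintro rfl; simp [List.nodup_append] at hnd
  have hlt := h (a ++ b) x y c (by simp) (lt_of_le_of_ne hyx hne)
  have hsub : Finset.range q ⊆ ((a ++ b).filter (· < y)).toFinset := by
    intro z hz
    have hz := Finset.mem_range.1 hz
    have := hall z hz
    have := hs y hy
    have := hc z
    simp only [List.toFinset_filter, List.mem_append, List.mem_cons, Finset.mem_filter,
      List.mem_toFinset, decide_eq_true_eq] at *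
    have : z ≠ x := by omega
    have : z ≠ y := by omega
    have : z ∉ c := fun h => by have := hc z h; omega
    refine ⟨by tauto, by omega⟩
  have := (Finset.card_le_card hsub).trans (List.toFinset_card_le _)
  simp only [Finset.card_range] at this
  omega

theorem GoodWord.append_cons {q v : ℕ} {a s : List ℕ} (h : GoodWord q a) (ha : a.Nodup)
    (hv : v < q) (hs : (v :: s).IsChain (· < ·)) : GoodWord q (a ++ v :: s) := by
  intro b x y c hbc hyx
  rcases List.append_eq_append_iff.1 hbc with ⟨d, rfl, hd⟩ | ⟨d, rfl, hd⟩
  · exact absurd (List.isChain_iff_forall_rel_of_append_cons_cons.1 hs hd) (by omega)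
  · rcases d with _ | ⟨x', _ | ⟨y', d⟩⟩
    · exact absurd (List.isChain_iff_forall_rel_of_append_cons_cons.1 hs (l₁ := []) hd.symm)
        (by omega)
    · simp only [List.cons_append, List.nil_append, List.cons.injEq] at hd
      obtain ⟨rfl, rfl, rfl⟩ := hd
      have hb : (b.filter (· < y)).Nodup := (List.nodup_append.1 ha).1.filter _
      rw [← List.toFinset_card_of_nodup hb]
      refine lt_of_le_of_lt (Finset.card_le_card (t := Finset.range y) ?_) (by simpa using hv)
      intro z hz
      simpa using (List.mem_filter.1 (List.mem_toFinset.1 hz)).2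
    · simp only [List.cons_append, List.cons.injEq] at hd
      obtain ⟨rfl, rfl, rfl⟩ := hd
      exact h b x y d rfl hyx

theorem card_goodWords_range {q n : ℕ} (hq' : 0 < q) (hn : q ≤ n) :
    #(goodWords q (Finset.range n)) = ∑ p ∈ Finset.range q ×ˢ (Finset.Ico q n).powerset,
      #(goodWords q (Finset.range n \ insert p.1 p.2)) := by
  rw [← Finset.card_sigma]
  symm
  refine Finset.card_bij (fun t _ => t.2 ++ t.1.1 :: t.1.2.sort) ?_ ?_ ?_
  · rintro ⟨⟨v, S⟩, l⟩ ht
    simp only [Finset.mem_sigma, Finset.mem_product, Finset.mem_range, Finset.mem_powerset,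
      mem_goodWords, Finset.mem_sdiff, Finset.mem_insert] at ht ⊢
    obtain ⟨⟨hv, hS⟩, ⟨hnd, hmem⟩, hgood⟩ := ht
    have hS' : ∀ x ∈ S, q ≤ x ∧ x < n := fun x hx => Finset.mem_Ico.1 (hS hx)
    refine ⟨⟨?_, ?_⟩, hgood.append_cons hnd hv ?_⟩
    · simp only [List.nodup_append, hnd, List.nodup_cons, Finset.mem_sort, Finset.sort_nodup,
        List.mem_cons, true_and, and_true]
      refine ⟨fun hvS => by have := hS' v hvS; omega, ?_⟩
      rintro x hx y hy rfl
      exact ((hmem x).1 hx).2 hy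
    · intro x
      simp only [List.mem_append, hmem, List.mem_cons, Finset.mem_sort]
      have := hS' x
      by_cases hxv : x = v
      · simp [hxv]; omega
      · by_cases hxS : x ∈ S
        · simp [hxS, this hxS]
        · simp [hxS, hxv]
    · refine List.Pairwise.isChain (List.pairwise_cons.2 ⟨?_, S.sortedLT_sort.pairwise⟩)
      intro x hx
      have := hS' x (by simpa using hx)
      omega
  · rintro ⟨⟨v, S⟩, l⟩ ht ⟨⟨v', S'⟩, l'⟩ ht' heq
    simp only [Finset.mem_sigma, Finset.mem_product, Finset.mem_range, Finset.mem_powerset]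
      at ht ht'
    obtain ⟨rfl, rfl, hSS⟩ := split_last_lt_unique heq ht.1.1 ht'.1.1
      (fun x hx => (Finset.mem_Ico.1 (ht.1.2 (by simpa using hx))).1)
      (fun x hx => (Finset.mem_Ico.1 (ht'.1.2 (by simpa using hx))).1)
    have : S = S' := by
      rw [← S.sort_toFinset (· ≤ ·), ← S'.sort_toFinset (· ≤ ·), hSS]
    rw [this]
  · intro l hl
    obtain ⟨⟨hnd, hmem⟩, hgood⟩ := mem_goodWords.1 hl
    simp only [Finset.mem_range] at hmem
    obtain ⟨a, v, s, rfl, hv, hs⟩ := exists_split_last_lt ⟨0, (hmem 0).2 (by omega), hq'⟩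
    have hchain := (hgood.isChain hnd hs fun x hx => (hmem x).2 (by omega)).pairwise
    have hsort : s.toFinset.sort = s :=
      (List.toFinset_sort (· ≤ ·) (List.pairwise_cons.1 hchain).2.nodup).2
        ((List.pairwise_cons.1 hchain).2.imp le_of_lt)
    refine ⟨⟨⟨v, s.toFinset⟩, a⟩, ?_, by simp only [hsort]⟩
    have hd := List.nodup_append.1 hnd
    simp only [Finset.mem_sigma, Finset.mem_product, Finset.mem_range, Finset.mem_powerset,
      mem_goodWords, Finset.mem_sdiff, Finset.mem_insert, List.mem_toFinset]
    refine ⟨⟨hv, fun x hx => ?_⟩, ⟨hd.1, fun x => ?_⟩, hgood.of_append⟩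
    · have hx := List.mem_toFinset.1 hx
      exact Finset.mem_Ico.2 ⟨hs x hx, (hmem x).1 (by simp [hx])⟩
    · rw [← hmem]
      have := fun h => hd.2.2 x h
      simp only [List.mem_append, List.mem_cons] at this ⊢
      refine ⟨fun h => ⟨Or.inl h, fun h' => this h x h' rfl⟩, fun h => ?_⟩
      tauto

/-- For all positive integers `q` and `n` with `n ≥ q`, the numbers of
`Pat(q)`-avoiding permutations satisfy
`h_q(n) = q · Σ_{k=0}^{n-q} C(n-q,k) · h_q(n-k-1)`. -/
theorem hq_recurrence (q n : ℕ) (hq' : 0 < q) (hn : q ≤ n) :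
    hq q n =
      q * ∑ k ∈ Finset.range (n - q + 1), Nat.choose (n - q) k * hq q (n - k - 1) := by
  rw [← Finset.card_range n, ← card_goodWords, card_goodWords_range hq' hn, Finset.card_range,
    Finset.sum_product]
  have hcard : ∀ v ∈ Finset.range q, ∀ S ∈ (Finset.Ico q n).powerset,
      #(goodWords q (Finset.range n \ insert v S)) = hq q (n - #S - 1) := by
    intro v hv S hS
    have hv := Finset.mem_range.1 hv
    have hS := Finset.mem_powerset.1 hS
    have hvS : v ∉ S := fun h => by have := Finset.mem_Ico.1 (hS h); omega
    rw [card_goodWords, Finset.card_sdiff_of_subset, Finset.card_insert_of_notMem hvS,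
      Finset.card_range, Nat.sub_sub]
    refine Finset.insert_subset (Finset.mem_range.2 (by omega)) fun x hx => ?_
    exact Finset.mem_range.2 (Finset.mem_Ico.1 (hS hx)).2
  rw [Finset.sum_congr rfl fun v hv => Finset.sum_congr rfl (hcard v hv), Finset.sum_const,
    Finset.card_range, smul_eq_mul, Finset.sum_powerset_apply_card (fun k => hq q (n - k - 1))]
  simp
end
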